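/- arXiv:2604.01895 — 2 statements merged into one kernel-verified Lean document; each statement's English description precedes it below -/
import Mathlib

section
/- Let N ≥ 2, let Ω ⊂ ℝ^N be a bounded domain with C³ boundary and unit volume, p ∈ (1, p_N), λ > 0, and let (α, ψ) be a solution of problem (P)_λ on Ω. Suppose φ ∈ C²(Ω̄) with φ = 0 on ∂Ω is a nontrivial eigenfunction of the linearized operator L_λ with eigenvalue σ = 0 (i.e. −Δφ = pλ V [φ] in Ω) and ⟨φ⟩ ≠ 0. Then ⟨[φ] ψ⟩ ≠ 0 and ⟨[φ] ψ⟩ has the same sign as ⟨φ⟩, i.e. ⟨φ⟩ · ⟨[φ] ψ⟩ > 0. -/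
open MeasureTheory Metric Set

noncomputable section

/-- The Laplacian of a function on Euclidean space. -/
def lapl {N : ℕ} (f : EuclideanSpace ℝ (Fin N) → ℝ) (x : EuclideanSpace ℝ (Fin N)) : ℝ :=
  ∑ i : Fin N,
    fderiv ℝ (fun y => fderiv ℝ f y (EuclideanSpace.single i (1 : ℝ))) x
      (EuclideanSpace.single i (1 : ℝ))

/-- `(α, ψ)` is a solution of problem `(P)_λ` on `Ω`:
`ψ ∈ C²`, `-Δψ = (max (α + λψ) 0)^p` in `Ω`, `ψ = 0` on `∂Ω`, and
`∫_Ω (max (α + λψ) 0)^p = 1`. -/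
def IsSol {N : ℕ} (Ω : Set (EuclideanSpace ℝ (Fin N))) (p lam α : ℝ)
    (ψ : EuclideanSpace ℝ (Fin N) → ℝ) : Prop :=
  ContDiff ℝ 2 ψ ∧
  (∀ x ∈ Ω, -lapl ψ x = (max (α + lam * ψ x) 0) ^ p) ∧
  (∀ x ∈ frontier Ω, ψ x = 0) ∧
  (∫ x in Ω, (max (α + lam * ψ x) 0) ^ p) = 1

/-- The weight `V = (max (α + λψ) 0)^(p-1)`. -/
def Vfun {N : ℕ} (p lam α : ℝ) (ψ : EuclideanSpace ℝ (Fin N) → ℝ)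
    (x : EuclideanSpace ℝ (Fin N)) : ℝ :=
  (max (α + lam * ψ x) 0) ^ (p - 1)

/-- `m = ∫_Ω V`. -/
def mV {N : ℕ} (Ω : Set (EuclideanSpace ℝ (Fin N))) (p lam α : ℝ)
    (ψ : EuclideanSpace ℝ (Fin N) → ℝ) : ℝ :=
  ∫ x in Ω, Vfun p lam α ψ x

/-- The weighted average `⟨φ⟩ = (∫_Ω V φ) / m`. -/
def avgV {N : ℕ} (Ω : Set (EuclideanSpace ℝ (Fin N))) (p lam α : ℝ)
    (ψ φ : EuclideanSpace ℝ (Fin N) → ℝ) : ℝ :=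
  (∫ x in Ω, Vfun p lam α ψ x * φ x) / mV Ω p lam α ψ

/-- `σ` is an eigenvalue of the linearized operator `L_λ` at the solution `(α, ψ)`:
there is a nontrivial `φ ∈ C²(Ω̄)` vanishing on `∂Ω` with `-Δφ = (pλ + σ) V [φ]` in `Ω`. -/
def IsEigen {N : ℕ} (Ω : Set (EuclideanSpace ℝ (Fin N))) (p lam α : ℝ)
    (ψ : EuclideanSpace ℝ (Fin N) → ℝ) (σ : ℝ) : Prop :=
  ∃ φ : EuclideanSpace ℝ (Fin N) → ℝ, ContDiff ℝ 2 φ ∧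
    (∃ x ∈ closure Ω, φ x ≠ 0) ∧ (∀ x ∈ frontier Ω, φ x = 0) ∧
    ∀ x ∈ Ω, -lapl φ x = (p * lam + σ) * (Vfun p lam α ψ x * (φ x - avgV Ω p lam α ψ φ))

/-- `Ω` is a bounded domain of class `C³`: open, connected, bounded, and near every
boundary point `Ω` is the sublevel set of a `C³` function with nonvanishing gradient. -/
def IsC3Domain {N : ℕ} (Ω : Set (EuclideanSpace ℝ (Fin N))) : Prop :=
  IsOpen Ω ∧ IsConnected Ω ∧ Bornology.IsBounded Ω ∧
  ∀ x ∈ frontier Ω, ∃ (U : Set (EuclideanSpace ℝ (Fin N)))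
      (f : EuclideanSpace ℝ (Fin N) → ℝ),
    IsOpen U ∧ x ∈ U ∧ ContDiff ℝ 3 f ∧ (∀ y ∈ U, fderiv ℝ f y ≠ 0) ∧
    Ω ∩ U = {y ∈ U | f y < 0}

/-- A smooth cutoff vanishing on `(-∞, 1]` and equal to `1` on `[2, ∞)`. -/
def cutoff (t : ℝ) : ℝ := Real.smoothTransition (t - 1)

lemma cutoff_contDiff : ContDiff ℝ 1 cutoff :=
  Real.smoothTransition.contDiff.comp (contDiff_id.sub contDiff_const)

lemma cutoff_of_le_one {t : ℝ} (ht : t ≤ 1) : cutoff t = 0 :=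
  Real.smoothTransition.zero_of_nonpos (by linarith)

lemma cutoff_of_two_le {t : ℝ} (ht : 2 ≤ t) : cutoff t = 1 :=
  Real.smoothTransition.one_of_one_le (by linarith)

lemma abs_cutoff_le (t : ℝ) : |cutoff t| ≤ 1 := by
  rw [cutoff, abs_of_nonneg (Real.smoothTransition.nonneg _)]
  exact Real.smoothTransition.le_one _

lemma deriv_cutoff_of_lt_one {t : ℝ} (ht : t < 1) : deriv cutoff t = 0 := by
  have h : cutoff =ᶠ[nhds t] fun _ => 0 := by
    filter_upwards [Iio_mem_nhds ht] with s hs using cutoff_of_le_one (le_of_lt hs)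
  rw [h.deriv_eq, deriv_const]

lemma deriv_cutoff_of_two_lt {t : ℝ} (ht : 2 < t) : deriv cutoff t = 0 := by
  have h : cutoff =ᶠ[nhds t] fun _ => 1 := by
    filter_upwards [Ioi_mem_nhds ht] with s hs using cutoff_of_two_le (le_of_lt hs)
  rw [h.deriv_eq, deriv_const]

lemma exists_bound_mul_deriv_cutoff : ∃ K, ∀ t, |t * deriv cutoff t| ≤ K := by
  have hc : Continuous fun t => t * deriv cutoff t :=
    continuous_id.mul (cutoff_contDiff.continuous_deriv le_rfl)
  have hs : HasCompactSupport fun t => t * deriv cutoff t := by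
    refine HasCompactSupport.intro (isCompact_Icc (a := (1 : ℝ)) (b := 2)) fun t ht => ?_
    rw [mem_Icc, not_and_or, not_le, not_le] at ht
    rcases ht with ht | ht
    · rw [deriv_cutoff_of_lt_one ht, mul_zero]
    · rw [deriv_cutoff_of_two_lt ht, mul_zero]
  obtain ⟨K, hK⟩ := hc.bounded_above_of_compact_support hs
  exact ⟨K, hK⟩

section Green

variable {N : ℕ} {Ω : Set (EuclideanSpace ℝ (Fin N))}

lemma integrableOn_of_continuous (hb : Bornology.IsBounded Ω)
    {f : EuclideanSpace ℝ (Fin N) → ℝ} (hf : Continuous f) : IntegrableOn f Ω :=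
  (hf.continuousOn.integrableOn_compact hb.isCompact_closure).mono_set subset_closure

lemma indicator_cutoff_eventuallyEq_zero {q : EuclideanSpace ℝ (Fin N) → ℝ}
    (hq : Continuous q) (hq0 : ∀ x ∈ frontier Ω, q x = 0)
    {x : EuclideanSpace ℝ (Fin N)} (hx : x ∉ Ω) :
    Ω.indicator (fun y => cutoff (q y)) =ᶠ[nhds x] fun _ => 0 := by
  by_cases hc : x ∈ closure Ω
  · have hxq : q x < 1 := by
      rw [hq0 x ⟨hc, fun h => hx (interior_subset h)⟩]; exact one_pos
    filter_upwards [hq.continuousAt.eventually_lt_const hxq] with y hy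
    by_cases hyΩ : y ∈ Ω
    · rw [indicator_of_mem hyΩ, cutoff_of_le_one hy.le]
    · rw [indicator_of_notMem hyΩ]
  · filter_upwards [isClosed_closure.isOpen_compl.mem_nhds hc] with y hy
    exact indicator_of_notMem (fun h => hy (subset_closure h)) _

lemma indicator_cutoff_eventuallyEq (ho : IsOpen Ω) (q : EuclideanSpace ℝ (Fin N) → ℝ)
    {x : EuclideanSpace ℝ (Fin N)} (hx : x ∈ Ω) :
    Ω.indicator (fun y => cutoff (q y)) =ᶠ[nhds x] fun y => cutoff (q y) := by
  filter_upwards [ho.mem_nhds hx] with y hy using indicator_of_mem hy _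

/-- Integration by parts against the cutoff of a function vanishing on the boundary. -/
lemma setIntegral_cutoff_mul_fderiv (ho : IsOpen Ω) (hb : Bornology.IsBounded Ω)
    {q w : EuclideanSpace ℝ (Fin N) → ℝ} (hq : ContDiff ℝ 1 q)
    (hq0 : ∀ x ∈ frontier Ω, q x = 0) (hw : ContDiff ℝ 1 w) (v : EuclideanSpace ℝ (Fin N)) :
    ∫ x in Ω, cutoff (q x) * fderiv ℝ w x v =
      -∫ x in Ω, deriv cutoff (q x) * fderiv ℝ q x v * w x := by
  set χ : EuclideanSpace ℝ (Fin N) → ℝ := Ω.indicator fun y => cutoff (q y) with hχ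
  have hcq : ContDiff ℝ 1 fun y => cutoff (q y) := cutoff_contDiff.comp hq
  have hχC : ContDiff ℝ 1 χ := by
    rw [contDiff_iff_contDiffAt]
    intro x
    by_cases hx : x ∈ Ω
    · exact hcq.contDiffAt.congr_of_eventuallyEq (indicator_cutoff_eventuallyEq ho q hx)
    · exact contDiffAt_const.congr_of_eventuallyEq
        (indicator_cutoff_eventuallyEq_zero hq.continuous hq0 hx)
  have hχs : HasCompactSupport χ :=
    HasCompactSupport.intro hb.isCompact_closure fun x hx =>
      indicator_of_notMem (fun h => hx (subset_closure h)) _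
  have hχd : Continuous fun x => fderiv ℝ χ x v :=
    (hχC.continuous_fderiv one_ne_zero).clm_apply continuous_const
  have hwd : Continuous fun x => fderiv ℝ w x v :=
    (hw.continuous_fderiv one_ne_zero).clm_apply continuous_const
  have hχds : HasCompactSupport fun x => fderiv ℝ χ x v := hχs.fderiv_apply ℝ v
  have key := integral_mul_fderiv_eq_neg_fderiv_mul_of_integrable (μ := volume)
    (f := χ) (g := w) (v := v)
    ((hχd.mul hw.continuous).integrable_of_hasCompactSupport hχds.mul_right)
    ((hχC.continuous.mul hwd).integrable_of_hasCompactSupport hχs.mul_right)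
    ((hχC.continuous.mul hw.continuous).integrable_of_hasCompactSupport hχs.mul_right)
    (fun x _ => hχC.differentiable one_ne_zero x) (fun x _ => hw.differentiable one_ne_zero x)
  rw [← integral_indicator ho.measurableSet, ← integral_indicator ho.measurableSet]
  have hl : Ω.indicator (fun x => cutoff (q x) * fderiv ℝ w x v) =
      fun x => χ x * fderiv ℝ w x v := by
    funext x
    by_cases hx : x ∈ Ω <;> simp [hχ, hx]
  have hr : Ω.indicator (fun x => deriv cutoff (q x) * fderiv ℝ q x v * w x) =
      fun x => fderiv ℝ χ x v * w x := by
    funext x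
    by_cases hx : x ∈ Ω
    · have h : HasFDerivAt (fun y => cutoff (q y)) (deriv cutoff (q x) • fderiv ℝ q x) x :=
        ((cutoff_contDiff.differentiable one_ne_zero) (q x)).hasDerivAt.comp_hasFDerivAt x
          ((hq.differentiable one_ne_zero) x).hasFDerivAt
      rw [indicator_of_mem hx, (indicator_cutoff_eventuallyEq ho q hx).fderiv_eq, h.fderiv]
      simp
    · rw [indicator_of_notMem hx,
        (indicator_cutoff_eventuallyEq_zero hq.continuous hq0 hx).fderiv_eq]
      simp
  rw [hl, hr]
  exact key

lemma contDiff_fderiv_apply {f : EuclideanSpace ℝ (Fin N) → ℝ} (hf : ContDiff ℝ 2 f)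
    (v : EuclideanSpace ℝ (Fin N)) : ContDiff ℝ 1 fun y => fderiv ℝ f y v :=
  (hf.fderiv_right (m := 1) (by norm_num)).clm_apply contDiff_const

lemma exists_bound_on (hb : Bornology.IsBounded Ω) {f : EuclideanSpace ℝ (Fin N) → ℝ}
    (hf : Continuous f) : ∃ M, 0 ≤ M ∧ ∀ x ∈ Ω, |f x| ≤ M := by
  obtain ⟨M, hM⟩ := hb.isCompact_closure.exists_bound_of_continuousOn hf.continuousOn
  exact ⟨|M|, abs_nonneg _, fun x hx => (hM x (subset_closure hx)).trans (le_abs_self M)⟩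

lemma abs_cutoff_flux_le {n s t a b M K c : ℝ} (hn : 0 ≤ n) (ha : |a| ≤ M) (hb : |b| ≤ M)
    (hK : |n * (s ^ 2 + t ^ 2) * c| ≤ K) :
    |c * (n * (2 * s * a + 2 * t * b)) * (s * b - t * a)| ≤ 4 * M ^ 2 * K := by
  have hM : 0 ≤ M := (abs_nonneg a).trans ha
  have h1 : |2 * s * a + 2 * t * b| ≤ 2 * M * (|s| + |t|) := by
    refine (abs_add_le _ _).trans ?_
    simp only [abs_mul, abs_two]
    nlinarith [mul_le_mul_of_nonneg_left ha (abs_nonneg s),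
      mul_le_mul_of_nonneg_left hb (abs_nonneg t)]
  have h2 : |s * b - t * a| ≤ M * (|s| + |t|) := by
    refine (abs_sub _ _).trans ?_
    simp only [abs_mul]
    nlinarith [mul_le_mul_of_nonneg_left hb (abs_nonneg s),
      mul_le_mul_of_nonneg_left ha (abs_nonneg t)]
  have h3 : (|s| + |t|) ^ 2 ≤ 2 * (s ^ 2 + t ^ 2) := by
    nlinarith [sq_abs s, sq_abs t, sq_nonneg (|s| - |t|)]
  have h4 : |2 * s * a + 2 * t * b| * |s * b - t * a| ≤ 4 * M ^ 2 * (s ^ 2 + t ^ 2) :=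
    (mul_le_mul h1 h2 (abs_nonneg _) (by positivity)).trans
      (by nlinarith [mul_le_mul_of_nonneg_left h3 (sq_nonneg M)])
  calc |c * (n * (2 * s * a + 2 * t * b)) * (s * b - t * a)|
      = |c| * n * (|2 * s * a + 2 * t * b| * |s * b - t * a|) := by
        simp only [abs_mul, abs_of_nonneg hn]; ring
    _ ≤ |c| * n * (4 * M ^ 2 * (s ^ 2 + t ^ 2)) := by gcongr
    _ = 4 * M ^ 2 * |n * (s ^ 2 + t ^ 2) * c| := by
        rw [abs_mul, abs_mul, abs_of_nonneg hn,
          abs_of_nonneg (add_nonneg (sq_nonneg s) (sq_nonneg t))]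
        ring
    _ ≤ 4 * M ^ 2 * K := by gcongr

/-- One-directional form of Green's second identity for functions vanishing on the boundary of
an arbitrary bounded open set. -/
lemma setIntegral_second_fderiv_wronskian (ho : IsOpen Ω) (hb : Bornology.IsBounded Ω)
    {f g : EuclideanSpace ℝ (Fin N) → ℝ} (hf : ContDiff ℝ 2 f) (hg : ContDiff ℝ 2 g)
    (hf0 : ∀ x ∈ frontier Ω, f x = 0) (hg0 : ∀ x ∈ frontier Ω, g x = 0)
    (v : EuclideanSpace ℝ (Fin N)) :
    ∫ x in Ω, (f x * fderiv ℝ (fun y => fderiv ℝ g y v) x v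
      - g x * fderiv ℝ (fun y => fderiv ℝ f y v) x v) = 0 := by
  have hfv := contDiff_fderiv_apply hf v
  have hgv := contDiff_fderiv_apply hg v
  have hf1 : ContDiff ℝ 1 f := hf.of_le (by norm_num)
  have hg1 : ContDiff ℝ 1 g := hg.of_le (by norm_num)
  set w : EuclideanSpace ℝ (Fin N) → ℝ :=
    fun x => f x * fderiv ℝ g x v - g x * fderiv ℝ f x v with hw
  have hwC : ContDiff ℝ 1 w := (hf1.mul hgv).sub (hg1.mul hfv)
  have hdw : ∀ x, fderiv ℝ w x v = f x * fderiv ℝ (fun y => fderiv ℝ g y v) x v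
      - g x * fderiv ℝ (fun y => fderiv ℝ f y v) x v := by
    intro x
    have h := (((hf1.differentiable one_ne_zero) x).hasFDerivAt.mul
      ((hgv.differentiable one_ne_zero) x).hasFDerivAt).sub
      (((hg1.differentiable one_ne_zero) x).hasFDerivAt.mul
      ((hfv.differentiable one_ne_zero) x).hasFDerivAt)
    have h' : fderiv ℝ w x = _ := h.fderiv
    rw [h']
    simp
    ring
  have hcdw : Continuous fun x => fderiv ℝ w x v :=
    (hwC.continuous_fderiv one_ne_zero).clm_apply continuous_const
  simp_rw [← hdw]
  let q : ℕ → EuclideanSpace ℝ (Fin N) → ℝ := fun n x => (n : ℝ) * (f x ^ 2 + g x ^ 2)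
  have hqC : ∀ n, ContDiff ℝ 1 (q n) := fun n =>
    contDiff_const.mul ((hf1.pow 2).add (hg1.pow 2))
  have hq0 : ∀ n, ∀ x ∈ frontier Ω, q n x = 0 := by
    intro n x hx
    simp [q, hf0 x hx, hg0 x hx]
  have hdq : ∀ n x, fderiv ℝ (q n) x v =
      n * (2 * f x * fderiv ℝ f x v + 2 * g x * fderiv ℝ g x v) := by
    intro n x
    have h := ((((hf1.differentiable one_ne_zero) x).hasFDerivAt.pow 2).add
      (((hg1.differentiable one_ne_zero) x).hasFDerivAt.pow 2)).const_mul (n : ℝ)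
    have h' : fderiv ℝ (q n) x = _ := h.fderiv
    rw [h']
    simp
    ring
  have hcdq : ∀ n, Continuous fun x => fderiv ℝ (q n) x v := fun n =>
    ((hqC n).continuous_fderiv one_ne_zero).clm_apply continuous_const
  have hqtop : ∀ x, f x ^ 2 + g x ^ 2 ≠ 0 →
      Filter.Tendsto (fun n => q n x) Filter.atTop Filter.atTop := fun x hx =>
    tendsto_natCast_atTop_atTop.atTop_mul_const (lt_of_le_of_ne (by positivity) hx.symm)
  have hfg : ∀ x, f x ^ 2 + g x ^ 2 = 0 → f x = 0 ∧ g x = 0 := by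
    intro x hx
    constructor <;> nlinarith [sq_nonneg (f x), sq_nonneg (g x)]
  have lim1 : Filter.Tendsto (fun n => ∫ x in Ω, cutoff (q n x) * fderiv ℝ w x v) Filter.atTop
      (nhds (∫ x in Ω, fderiv ℝ w x v)) := by
    refine tendsto_integral_of_dominated_convergence (fun x => |fderiv ℝ w x v|) ?_ ?_ ?_ ?_
    · intro n
      exact ((cutoff_contDiff.continuous.comp (hqC n).continuous).mul hcdw).aestronglyMeasurable
    · exact integrableOn_of_continuous hb hcdw.abs
    · intro n
      refine Filter.Eventually.of_forall fun x => ?_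
      rw [Real.norm_eq_abs, abs_mul]
      exact mul_le_of_le_one_left (abs_nonneg _) (abs_cutoff_le _)
    · refine Filter.Eventually.of_forall fun x => ?_
      by_cases hx : f x ^ 2 + g x ^ 2 = 0
      · simp [hdw, (hfg x hx).1, (hfg x hx).2]
      · refine tendsto_const_nhds.congr' ?_
        filter_upwards [(hqtop x hx).eventually_ge_atTop 2] with n hn
        rw [cutoff_of_two_le hn, one_mul]
  have lim2 : Filter.Tendsto
      (fun n => ∫ x in Ω, deriv cutoff (q n x) * fderiv ℝ (q n) x v * w x) Filter.atTop
      (nhds (∫ _ in Ω, (0 : ℝ))) := by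
    obtain ⟨K, hK⟩ := exists_bound_mul_deriv_cutoff
    obtain ⟨M₁, hM₁, hM₁'⟩ := exists_bound_on hb hfv.continuous
    obtain ⟨M₂, hM₂, hM₂'⟩ := exists_bound_on hb hgv.continuous
    refine tendsto_integral_of_dominated_convergence
      (fun _ => 4 * (M₁ + M₂) ^ 2 * K) ?_ ?_ ?_ ?_
    · intro n
      exact ((((cutoff_contDiff.continuous_deriv le_rfl).comp (hqC n).continuous).mul
        (hcdq n)).mul hwC.continuous).aestronglyMeasurable
    · exact integrableOn_of_continuous hb continuous_const
    · intro n
      filter_upwards [ae_restrict_mem ho.measurableSet] with x hx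
      rw [Real.norm_eq_abs, hdq]
      exact abs_cutoff_flux_le n.cast_nonneg ((hM₁' x hx).trans (by linarith))
        ((hM₂' x hx).trans (by linarith)) (hK (q n x))
    · refine Filter.Eventually.of_forall fun x => ?_
      by_cases hx : f x ^ 2 + g x ^ 2 = 0
      · simp [hw, (hfg x hx).1, (hfg x hx).2]
      · refine tendsto_const_nhds.congr' ?_
        filter_upwards [(hqtop x hx).eventually_gt_atTop 2] with n hn
        rw [deriv_cutoff_of_two_lt hn, zero_mul, zero_mul]
  have heq := fun n => setIntegral_cutoff_mul_fderiv ho hb (hqC n) (hq0 n) hwC v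
  simp_rw [heq] at lim1
  have := tendsto_nhds_unique lim1 lim2.neg
  simpa using this

/-- Green's second identity for functions vanishing on the boundary of a bounded open set. -/
lemma setIntegral_mul_lapl_comm (ho : IsOpen Ω) (hb : Bornology.IsBounded Ω)
    {f g : EuclideanSpace ℝ (Fin N) → ℝ} (hf : ContDiff ℝ 2 f) (hg : ContDiff ℝ 2 g)
    (hf0 : ∀ x ∈ frontier Ω, f x = 0) (hg0 : ∀ x ∈ frontier Ω, g x = 0) :
    ∫ x in Ω, (f x * lapl g x - g x * lapl f x) = 0 := by
  have hc : ∀ {h : EuclideanSpace ℝ (Fin N) → ℝ}, ContDiff ℝ 2 h → ∀ v,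
      Continuous fun x => fderiv ℝ (fun y => fderiv ℝ h y v) x v := fun hh v =>
    ((contDiff_fderiv_apply hh v).continuous_fderiv one_ne_zero).clm_apply continuous_const
  simp_rw [lapl, Finset.mul_sum, ← Finset.sum_sub_distrib]
  rw [integral_finsetSum]
  · exact Finset.sum_eq_zero fun i _ =>
      setIntegral_second_fderiv_wronskian ho hb hf hg hf0 hg0 _
  · exact fun i _ => integrableOn_of_continuous hb
      ((hf.continuous.mul (hc hg _)).sub (hg.continuous.mul (hc hf _)))

end Green

theorem stmt17 (N : ℕ) (hN : 2 ≤ N) (Ω : Set (EuclideanSpace ℝ (Fin N)))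
    (hΩ : IsC3Domain Ω) (hvol : volume Ω = 1) (p : ℝ) (hp1 : 1 < p)
    (hpN : N = 2 ∨ p < (N : ℝ) / ((N : ℝ) - 2))
    (lam : ℝ) (hlam : 0 < lam) (α : ℝ) (ψ φ : EuclideanSpace ℝ (Fin N) → ℝ)
    (hsol : IsSol Ω p lam α ψ)
    (hφreg : ContDiff ℝ 2 φ) (hφne : ∃ x ∈ closure Ω, φ x ≠ 0)
    (hφbd : ∀ x ∈ frontier Ω, φ x = 0)
    (hφeq : ∀ x ∈ Ω,
      -lapl φ x = p * lam * (Vfun p lam α ψ x * (φ x - avgV Ω p lam α ψ φ)))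
    (havg : avgV Ω p lam α ψ φ ≠ 0) :
    0 < avgV Ω p lam α ψ φ *
      ((∫ x in Ω, Vfun p lam α ψ x * ((φ x - avgV Ω p lam α ψ φ) * ψ x)) /
        mV Ω p lam α ψ) := by
  obtain ⟨ho, -, hb, -⟩ := hΩ
  obtain ⟨hψreg, hψeq, hψbd, hmass⟩ := hsol
  have hVc : Continuous (Vfun p lam α ψ) :=
    ((continuous_const.add (continuous_const.mul hψreg.continuous)).max
      continuous_const).rpow_const fun _ => Or.inr (by linarith)
  have hm : 0 < mV Ω p lam α ψ := by
    refine lt_of_le_of_ne (integral_nonneg fun x => Real.rpow_nonneg (le_max_right _ _) _) ?_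
    intro h
    exact havg (by rw [avgV, ← h, div_zero])
  have hrpow : ∀ x, (max (α + lam * ψ x) 0) ^ p = Vfun p lam α ψ x * (α + lam * ψ x) := by
    intro x
    rw [Vfun]
    rcases le_or_gt (α + lam * ψ x) 0 with h | h
    · rw [max_eq_right h, Real.zero_rpow (by linarith), Real.zero_rpow (by linarith), zero_mul]
    · rw [max_eq_left h.le, Real.rpow_sub_one h.ne', div_mul_cancel₀ _ h.ne']
  set V := Vfun p lam α ψ
  set a := avgV Ω p lam α ψ φ with ha
  set m := mV Ω p lam α ψ with hmdef
  have iV : IntegrableOn V Ω := integrableOn_of_continuous hb hVc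
  have iVφ : IntegrableOn (fun x => V x * φ x) Ω :=
    integrableOn_of_continuous hb (hVc.mul hφreg.continuous)
  have iVψ : IntegrableOn (fun x => V x * ψ x) Ω :=
    integrableOn_of_continuous hb (hVc.mul hψreg.continuous)
  have iVφψ : IntegrableOn (fun x => V x * ((φ x - a) * ψ x)) Ω :=
    integrableOn_of_continuous hb
      (hVc.mul ((hφreg.continuous.sub continuous_const).mul hψreg.continuous))
  have hVφ : ∫ x in Ω, V x * φ x = a * m := by
    rw [ha, avgV, ← hmdef, div_mul_cancel₀ _ hm.ne']
  have hVm : ∫ x in Ω, V x = m := rfl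
  have hone : α * m + lam * ∫ x in Ω, V x * ψ x = 1 := by
    rw [← hmass, ← hVm, ← integral_const_mul, ← integral_const_mul,
      ← integral_add (iV.const_mul α) (iVψ.const_mul lam)]
    refine integral_congr_ae (Filter.Eventually.of_forall fun x => ?_)
    simp only [hrpow]
    ring
  have hgreen : (p - 1) * lam * (∫ x in Ω, V x * ((φ x - a) * ψ x)) = a := by
    have h := setIntegral_mul_lapl_comm ho hb hψreg hφreg hψbd hφbd
    have iαφ : IntegrableOn (fun x => α * (V x * φ x)) Ω := iVφ.const_mul α
    have iaψ : IntegrableOn (fun x => lam * a * (V x * ψ x)) Ω := iVψ.const_mul (lam * a)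
    have iadd : IntegrableOn (fun x => α * (V x * φ x) + lam * a * (V x * ψ x)) Ω := iαφ.add iaψ
    have h' : ∫ x in Ω, (ψ x * lapl φ x - φ x * lapl ψ x) =
        ∫ x in Ω, (α * (V x * φ x) + lam * a * (V x * ψ x)
          - (p - 1) * lam * (V x * ((φ x - a) * ψ x))) := by
      refine setIntegral_congr_fun ho.measurableSet fun x hx => ?_
      have h1 := hφeq x hx
      have h2 := hψeq x hx
      rw [hrpow] at h2
      linear_combination (-ψ x) * h1 + φ x * h2
    rw [h', integral_sub iadd (iVφψ.const_mul ((p - 1) * lam)),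
      integral_add iαφ iaψ, integral_const_mul,
      integral_const_mul, integral_const_mul, hVφ] at h
    linear_combination a * hone - h
  set I := ∫ x in Ω, V x * ((φ x - a) * ψ x)
  have hsq : 0 < a * I := by
    have hpos : 0 < (p - 1) * lam := mul_pos (by linarith) hlam
    refine pos_of_mul_pos_right (a := (p - 1) * lam) ?_ hpos.le
    have : (p - 1) * lam * (a * I) = a ^ 2 := by linear_combination a * hgreen
    rw [this]
    positivity
  rw [← mul_div_assoc]
  exact div_pos hsq hm

end
end

section
/- Let N ≥ 2 and p ∈ (1, p_N). The Emden problem on the unit ball B₁ ⊂ ℝ^N admits exactly one solution: there exists u ∈ C²(B̄₁) with −Δu = u^p in B₁, u > 0 in B₁ and u = 0 on ∂B₁, and any two such functions coincide. -/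
open MeasureTheory Metric Set

noncomputable section

/-- `u` solves the Emden problem on `Ω`: `u ∈ C²`, `-Δu = u^p` and `u > 0` in `Ω`,
`u = 0` on `∂Ω`. -/
def IsEmden {N : ℕ} (Ω : Set (EuclideanSpace ℝ (Fin N))) (p : ℝ)
    (u : EuclideanSpace ℝ (Fin N) → ℝ) : Prop :=
  ContDiff ℝ 2 u ∧ (∀ x ∈ Ω, -lapl u x = u x ^ p) ∧ (∀ x ∈ Ω, 0 < u x) ∧
  ∀ x ∈ frontier Ω, u x = 0

section

open Filter Topology
open scoped InnerProductSpace Laplacian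

section

variable {E : Type*} [NormedAddCommGroup E] [InnerProductSpace ℝ E]

lemma eventually_line (x v : E) {P : E → Prop} (h : ∀ᶠ y in 𝓝 x, P y) :
    ∀ᶠ s : ℝ in 𝓝 0, P (x + s • v) := by
  have hc : Tendsto (fun s : ℝ => x + s • v) (𝓝 0) (𝓝 x) := by
    have : Continuous fun s : ℝ => x + s • v := by fun_prop
    simpa using this.tendsto 0
  exact hc.eventually h

lemma hasDerivAt_line (f : E → ℝ) (x v : E) (s : ℝ) (hf : DifferentiableAt ℝ f (x + s • v)) :
    HasDerivAt (fun t : ℝ => f (x + t • v)) (fderiv ℝ f (x + s • v) v) s := by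
  have h1 : HasDerivAt (fun t : ℝ => x + t • v) v s := by
    simpa using ((hasDerivAt_id s).smul_const v).const_add x
  exact hf.hasFDerivAt.comp_hasDerivAt s h1

lemma ContDiffAt.eventually_hasDerivAt_line {f : E → ℝ} {x : E} (hf : ContDiffAt ℝ 2 f x)
    (v : E) : ∀ᶠ s : ℝ in 𝓝 0,
      HasDerivAt (fun t : ℝ => f (x + t • v)) (fderiv ℝ f (x + s • v) v) s := by
  have h : ∀ᶠ y in 𝓝 x, DifferentiableAt ℝ f y := by
    filter_upwards [hf.eventually (by simp)] with y hy using hy.differentiableAt (by simp)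
  filter_upwards [eventually_line x v h] with s hs using hasDerivAt_line f x v s hs

lemma ContDiffAt.hasDerivAt_fderiv_line {f : E → ℝ} {x : E} (hf : ContDiffAt ℝ 2 f x) (v : E) :
    HasDerivAt (fun s : ℝ => fderiv ℝ f (x + s • v) v) (fderiv ℝ (fderiv ℝ f) x v v) 0 := by
  have hd : DifferentiableAt ℝ (fderiv ℝ f) x :=
    (hf.fderiv_right (m := 1) (by norm_num)).differentiableAt (by simp)
  have h1 : HasDerivAt (fun t : ℝ => x + t • v) v 0 := by
    simpa using ((hasDerivAt_id (0 : ℝ)).smul_const v).const_add x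
  have h2 : HasFDerivAt (fderiv ℝ f) (fderiv ℝ (fderiv ℝ f) x) (x + (0 : ℝ) • v) := by
    simpa using hd.hasFDerivAt
  have h3 := h2.comp_hasDerivAt (0 : ℝ) h1
  exact ((ContinuousLinearMap.apply ℝ ℝ v).hasFDerivAt).comp_hasDerivAt (0 : ℝ) h3

/-- The second derivative of `f` in the direction `v`, computed along a line. -/
lemma ContDiffAt.fderiv_fderiv_apply_self_eq {f : E → ℝ} {x v : E} (hf : ContDiffAt ℝ 2 f x)
    {a : ℝ → ℝ} {b : ℝ}
    (ha : ∀ᶠ s : ℝ in 𝓝 0, HasDerivAt (fun t : ℝ => f (x + t • v)) (a s) s)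
    (hb : HasDerivAt a b 0) : fderiv ℝ (fderiv ℝ f) x v v = b := by
  have h := hf.hasDerivAt_fderiv_line v
  have he : a =ᶠ[𝓝 0] fun s : ℝ => fderiv ℝ f (x + s • v) v := by
    filter_upwards [ha, hf.eventually_hasDerivAt_line v] with s h1 h2 using h1.unique h2
  exact (h.congr_of_eventuallyEq he).unique hb

lemma IsLocalMin.fderiv_fderiv_nonneg {f : E → ℝ} {x : E} (h : IsLocalMin f x)
    (hf : ContDiffAt ℝ 2 f x) (v : E) : 0 ≤ fderiv ℝ (fderiv ℝ f) x v v := by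
  set g : ℝ → ℝ := fun t => f (x + t • v) with hg
  have hmin : IsLocalMin g 0 := by
    have := eventually_line x v h
    simpa [IsLocalMin, IsMinFilter, hg] using this
  have hd : deriv g =ᶠ[𝓝 0] fun s : ℝ => fderiv ℝ f (x + s • v) v := by
    filter_upwards [hf.eventually_hasDerivAt_line v] with s hs using hs.deriv
  have hdd : deriv (deriv g) 0 = fderiv ℝ (fderiv ℝ f) x v v :=
    ((hf.hasDerivAt_fderiv_line v).congr_of_eventuallyEq hd).deriv
  by_contra! hneg
  have hmax : IsLocalMax g 0 := isLocalMax_of_deriv_deriv_neg (by rwa [hdd]) hmin.deriv_eq_zero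
    (by simpa using (hf.eventually_hasDerivAt_line v).self_of_nhds.continuousAt)
  have hconst : g =ᶠ[𝓝 0] fun _ => g 0 := by
    filter_upwards [hmin, hmax] with s h1 h2 using le_antisymm h2 h1
  have : deriv (deriv g) 0 = 0 := by
    rw [(hconst.deriv).deriv_eq]
    simp
  linarith

variable [FiniteDimensional ℝ E]

lemma laplacian_eq_sum_fderiv_fderiv {ι : Type*} [Fintype ι] (b : OrthonormalBasis ι ℝ E)
    (f : E → ℝ) (x : E) : Δ f x = ∑ i, fderiv ℝ (fderiv ℝ f) x (b i) (b i) := by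
  rw [InnerProductSpace.laplacian_eq_iteratedFDeriv_orthonormalBasis f b]
  simp [iteratedFDeriv_two_apply]

lemma IsLocalMin.laplacian_nonneg {f : E → ℝ} {x : E} (h : IsLocalMin f x)
    (hf : ContDiffAt ℝ 2 f x) : 0 ≤ Δ f x := by
  rw [laplacian_eq_sum_fderiv_fderiv (stdOrthonormalBasis ℝ E)]
  exact Finset.sum_nonneg fun i _ => h.fderiv_fderiv_nonneg hf _

lemma laplacian_comp_isometry {f : E → ℝ} (R : E ≃ₗᵢ[ℝ] E) (c x : E)
    (hf : ContDiffAt ℝ 2 f (R x + c)) : Δ (fun y => f (R y + c)) x = Δ f (R x + c) := by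
  have hR : ContDiff ℝ 2 (fun y => R y + c) := R.contDiff.add contDiff_const
  have hfR : ContDiffAt ℝ 2 (fun y => f (R y + c)) x := hf.comp x hR.contDiffAt
  let b := stdOrthonormalBasis ℝ E
  rw [laplacian_eq_sum_fderiv_fderiv b, laplacian_eq_sum_fderiv_fderiv (b.map R)]
  refine Finset.sum_congr rfl fun i _ => ?_
  refine hfR.fderiv_fderiv_apply_self_eq (a := fun s => fderiv ℝ f (R x + c + s • R (b i)) (R (b i)))
    ?_ ?_
  · filter_upwards [hf.eventually_hasDerivAt_line (R (b i))] with s hs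
    convert hs using 3 with t
    simp only [map_add, map_smul]
    abel
  · simpa using hf.hasDerivAt_fderiv_line (R (b i))

lemma laplacian_comp_norm_sq {G : ℝ → ℝ} (y x : E)
    (hG : ContDiffAt ℝ 2 G (‖x - y‖ ^ 2)) :
    Δ (fun z => G (‖z - y‖ ^ 2)) x =
      4 * ‖x - y‖ ^ 2 * deriv (deriv G) (‖x - y‖ ^ 2)
        + 2 * Module.finrank ℝ E * deriv G (‖x - y‖ ^ 2) := by
  have hn : ContDiff ℝ 2 (fun z : E => ‖z - y‖ ^ 2) :=
    (contDiff_id.sub contDiff_const).norm_sq ℝ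
  have hf : ContDiffAt ℝ 2 (fun z => G (‖z - y‖ ^ 2)) x :=
    ContDiffAt.comp (f := fun z : E => ‖z - y‖ ^ 2) x hG hn.contDiffAt
  let b := stdOrthonormalBasis ℝ E
  have key : ∀ v : E, fderiv ℝ (fderiv ℝ (fun z => G (‖z - y‖ ^ 2))) x v v =
      deriv (deriv G) (‖x - y‖ ^ 2) * (2 * ⟪x - y, v⟫_ℝ) ^ 2
        + deriv G (‖x - y‖ ^ 2) * (2 * ‖v‖ ^ 2) := by
    intro v
    have hq : ∀ s : ℝ, ‖x + s • v - y‖ ^ 2 =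
        ‖x - y‖ ^ 2 + 2 * s * ⟪x - y, v⟫_ℝ + s ^ 2 * ‖v‖ ^ 2 := by
      intro s
      rw [show x + s • v - y = (x - y) + s • v by abel, norm_add_sq_real, inner_smul_right,
        norm_smul, mul_pow, Real.norm_eq_abs, sq_abs]
      ring
    have hqd : ∀ s : ℝ, HasDerivAt (fun t : ℝ => ‖x + t • v - y‖ ^ 2)
        (2 * ⟪x - y, v⟫_ℝ + 2 * s * ‖v‖ ^ 2) s := by
      intro s
      simp only [hq]
      have h := ((((hasDerivAt_id s).const_mul 2).mul_const ⟪x - y, v⟫_ℝ).const_add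
        (‖x - y‖ ^ 2)).add (((hasDerivAt_id s).pow 2).mul_const (‖v‖ ^ 2))
      refine h.congr_deriv ?_
      simp
    have hdG : ∀ᶠ z in 𝓝 x, DifferentiableAt ℝ G (‖z - y‖ ^ 2) :=
      (hn.continuous.tendsto x).eventually
        ((hG.eventually (by simp)).mono fun z hz => hz.differentiableAt (by simp))
    have hdG2 : HasDerivAt (deriv G) (deriv (deriv G) (‖x - y‖ ^ 2)) (‖x + (0 : ℝ) • v - y‖ ^ 2) := by
      have h1 : ContDiffAt ℝ 1 (deriv G) (‖x - y‖ ^ 2) := by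
        exact hG.derivWithin (by norm_num)
      simpa using (h1.differentiableAt (by simp)).hasDerivAt
    refine hf.fderiv_fderiv_apply_self_eq
      (a := fun s => deriv G (‖x + s • v - y‖ ^ 2) * (2 * ⟪x - y, v⟫_ℝ + 2 * s * ‖v‖ ^ 2)) ?_ ?_
    · filter_upwards [eventually_line x v hdG] with s hs
      exact hs.hasDerivAt.comp s (hqd s)
    · have h1 := hdG2.comp (0 : ℝ) (hqd 0)
      have h2 : HasDerivAt (fun s : ℝ => 2 * ⟪x - y, v⟫_ℝ + 2 * s * ‖v‖ ^ 2) (2 * ‖v‖ ^ 2) 0 := by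
        simpa using (((hasDerivAt_id (0 : ℝ)).const_mul 2).mul_const (‖v‖ ^ 2)).const_add
          (2 * ⟪x - y, v⟫_ℝ)
      have h3 := h1.mul h2
      refine h3.congr_deriv ?_
      simp
      ring
  rw [laplacian_eq_sum_fderiv_fderiv b]
  simp only [key, b.norm_eq_one]
  rw [Finset.sum_add_distrib, ← Finset.mul_sum]
  simp only [mul_pow, ← Finset.mul_sum]
  rw [b.sum_sq_inner_left]
  simp
  ring

lemma laplacian_one_sub_mul_inner_sub_sq (e x : E) (he : ‖e‖ = 1) (C l : ℝ) :
    Δ (fun z : E => (1 - C * (⟪z, e⟫_ℝ - l) ^ 2 : ℝ)) x = (- 2 * C : ℝ) := by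
  have hf : ContDiff ℝ 2 (fun z : E => 1 - C * (⟪z, e⟫_ℝ - l) ^ 2) :=
    contDiff_const.sub (contDiff_const.mul
      (((contDiff_id.inner ℝ contDiff_const).sub contDiff_const).pow 2))
  let b := stdOrthonormalBasis ℝ E
  have key : ∀ v : E, fderiv ℝ (fderiv ℝ (fun z : E => 1 - C * (⟪z, e⟫_ℝ - l) ^ 2)) x v v =
      - 2 * C * ⟪e, v⟫_ℝ ^ 2 := by
    intro v
    have hqd : ∀ s : ℝ, HasDerivAt (fun t : ℝ => ⟪x + t • v, e⟫_ℝ - l) ⟪e, v⟫_ℝ s := by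
      intro s
      simp only [inner_add_left, inner_smul_left, real_inner_comm v e]
      simpa using (((hasDerivAt_id s).mul_const ⟪v, e⟫_ℝ).const_add ⟪x, e⟫_ℝ).sub_const l
    refine hf.contDiffAt.fderiv_fderiv_apply_self_eq
      (a := fun s => - (C * (2 * (⟪x + s • v, e⟫_ℝ - l) * ⟪e, v⟫_ℝ))) ?_ ?_
    · refine Eventually.of_forall fun s => ?_
      simpa using (((hqd s).pow 2).const_mul C).const_sub 1
    · have := ((((hqd 0).const_mul 2).mul_const ⟪e, v⟫_ℝ).const_mul C).neg
      refine this.congr_deriv ?_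
      ring
  rw [laplacian_eq_sum_fderiv_fderiv b]
  simp only [key]
  rw [← Finset.mul_sum, b.sum_sq_inner_left]
  simp [he]

end

section

variable {E : Type*} [NormedAddCommGroup E] [InnerProductSpace ℝ E] [FiniteDimensional ℝ E]

/-- Weak minimum principle: a function on a compact set is nonnegative if its Laplacian is
negative at every interior point where the function is negative. -/
lemma nonneg_of_laplacian_neg {K : Set E} (hK : IsCompact K) {f : E → ℝ} (hf : ContinuousOn f K)
    (h : ∀ x ∈ K, 0 ≤ f x ∨ (K ∈ 𝓝 x ∧ ContDiffAt ℝ 2 f x ∧ Δ f x < 0)) :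
    ∀ x ∈ K, 0 ≤ f x := by
  intro x hx
  obtain ⟨x₀, hx₀, hmin⟩ := hK.exists_isMinOn ⟨x, hx⟩ hf
  rcases h x₀ hx₀ with h0 | ⟨hn, hd, hlap⟩
  · exact h0.trans (hmin hx)
  · exact absurd ((hmin.isLocalMin hn).laplacian_nonneg hd) hlap.not_ge

/-- Minimum principle for `Δ + C` in a narrow slab. -/
lemma nonneg_of_laplacian_le_of_narrow {K : Set E} (hK : IsCompact K) {w : E → ℝ}
    (hw : ContDiff ℝ 2 w) {e : E} (he : ‖e‖ = 1) {l d C : ℝ} (hC : 0 < C) (hCd : C * d ^ 2 < 1)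
    (hKl : ∀ x ∈ K, l ≤ ⟪x, e⟫_ℝ ∧ ⟪x, e⟫_ℝ ≤ l + d)
    (h : ∀ x ∈ K, 0 ≤ w x ∨ (K ∈ 𝓝 x ∧ Δ w x ≤ -C * w x)) :
    ∀ x ∈ K, 0 ≤ w x := by
  set g : E → ℝ := fun z => 1 - C * (⟪z, e⟫_ℝ - l) ^ 2 with hg
  have hgd : ContDiff ℝ 2 g := contDiff_const.sub (contDiff_const.mul
      (((contDiff_id.inner ℝ contDiff_const).sub contDiff_const).pow 2))
  have hgpos : ∀ x ∈ K, 0 < g x := by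
    intro x hx
    obtain ⟨h1, h2⟩ := hKl x hx
    have : (⟪x, e⟫_ℝ - l) ^ 2 ≤ d ^ 2 := pow_le_pow_left₀ (by linarith) (by linarith) 2
    have := mul_le_mul_of_nonneg_left this hC.le
    simp only [hg]
    linarith
  have hg1 : ∀ x, g x ≤ 1 := fun x => by
    have := mul_nonneg hC.le (sq_nonneg (⟪x, e⟫_ℝ - l))
    simp only [hg]
    linarith
  intro x hx
  by_contra! hneg
  obtain ⟨x₀, hx₀, hmin⟩ := hK.exists_isMinOn ⟨x, hx⟩
    (f := fun z => w z / g z)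
    (hw.continuous.continuousOn.div hgd.continuous.continuousOn fun z hz => (hgpos z hz).ne')
  set m : ℝ := -(w x₀ / g x₀) with hm
  have hmpos : 0 < m := by
    have h1 : w x₀ / g x₀ ≤ w x / g x := hmin hx
    have h2 : w x / g x < 0 := div_neg_of_neg_of_pos hneg (hgpos x hx)
    linarith
  have hw0 : w x₀ = -(m * g x₀) := by
    rw [hm]
    field_simp [(hgpos x₀ hx₀).ne']
  have hmg : ContDiff ℝ 2 (m • g) := contDiff_const.smul hgd
  have hminf : IsMinOn (w + m • g) K x₀ := by
    intro y hy
    have h1 : w x₀ / g x₀ ≤ w y / g y := hmin hy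
    have h2 : -m ≤ w y / g y := by rw [hm]; simpa using h1
    rw [le_div_iff₀ (hgpos y hy)] at h2
    simp only [mem_ofPred_eq, Pi.add_apply, Pi.smul_apply, smul_eq_mul, hw0]
    linarith
  have hwneg : w x₀ < 0 := by
    rw [hw0]
    have := mul_pos hmpos (hgpos x₀ hx₀)
    linarith
  rcases h x₀ hx₀ with h0 | ⟨hn, hlap⟩
  · linarith
  have hΔ := (hminf.isLocalMin hn).laplacian_nonneg (hw.add hmg).contDiffAt
  rw [hw.contDiffAt.laplacian_add hmg.contDiffAt,
    InnerProductSpace.laplacian_smul m hgd.contDiffAt,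
    laplacian_one_sub_mul_inner_sub_sq e x₀ he C l, smul_eq_mul] at hΔ
  rw [hw0] at hlap
  have h3 : m * C * (g x₀ - 2) < 0 :=
    mul_neg_of_pos_of_neg (mul_pos hmpos hC) (by linarith [hg1 x₀])
  nlinarith

/-- A nonnegative superharmonic function on a ball that is positive at the center is positive. -/
lemma pos_of_laplacian_nonpos_ball {w : E → ℝ} (hw : ContDiff ℝ 2 w) {y : E} {R : ℝ}
    (hnn : ∀ x ∈ closedBall y R, 0 ≤ w x) (hlap : ∀ x ∈ ball y R, Δ w x ≤ 0) (hy : 0 < w y) :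
    ∀ x ∈ ball y R, 0 < w x := by
  obtain ⟨r, hr, hball⟩ : ∃ r > 0, ∀ x ∈ closedBall y r, w y / 2 < w x := by
    obtain ⟨r, hr, h⟩ := Metric.nhds_basis_closedBall.eventually_iff.1
      (hw.continuous.continuousAt.eventually (lt_mem_nhds (half_lt_self hy)))
    exact ⟨r, hr, fun x hx => h hx⟩
  set m := w y / 2 with hm
  have hmpos : 0 < m := half_pos hy
  set a : ℝ := (Module.finrank ℝ E + 1) / (2 * r ^ 2) with ha
  have hapos : 0 < a := by positivity
  have har : 2 * a * r ^ 2 = Module.finrank ℝ E + 1 := by rw [ha]; field_simp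
  set G : ℝ → ℝ := fun t => m * (Real.exp (-a * R ^ 2) - Real.exp (-a * t)) with hG
  have hGd : ContDiff ℝ 2 G := by fun_prop
  have hexp : ∀ t, HasDerivAt (fun t : ℝ => Real.exp (-a * t)) (-a * Real.exp (-a * t)) t := by
    intro t
    have := ((hasDerivAt_id t).const_mul (-a)).exp
    refine this.congr_deriv ?_
    simp
    ring
  have hG1 : deriv G = fun t => m * a * Real.exp (-a * t) := by
    funext t
    refine (((hexp t).const_sub _).const_mul m).deriv.trans ?_
    ring
  have hG2 : ∀ t, deriv (deriv G) t = -(m * a ^ 2 * Real.exp (-a * t)) := by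
    intro t
    rw [hG1]
    refine ((hexp t).const_mul (m * a)).deriv.trans ?_
    ring
  have hGc : ContDiff ℝ 2 (fun z : E => G (‖z - y‖ ^ 2)) :=
    hGd.comp ((contDiff_id.sub contDiff_const).norm_sq ℝ)
  have hK : IsCompact (closedBall y R \ ball y r) := (isCompact_closedBall y R).diff isOpen_ball
  have key := nonneg_of_laplacian_neg hK (f := w + fun z : E => G (‖z - y‖ ^ 2))
    (hw.add hGc).continuous.continuousOn ?_
  · intro x hx
    by_cases hxr : x ∈ ball y r
    · exact hmpos.trans (hball _ (ball_subset_closedBall hxr))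
    · have h1 := key x ⟨ball_subset_closedBall hx, hxr⟩
      have h2 : G (‖x - y‖ ^ 2) < 0 := by
        have hlt : ‖x - y‖ ^ 2 < R ^ 2 :=
          pow_lt_pow_left₀ (mem_ball_iff_norm.1 hx) (norm_nonneg _) two_ne_zero
        refine mul_neg_of_pos_of_neg hmpos (sub_neg.2 (Real.exp_lt_exp.2 ?_))
        nlinarith
      simp only [Pi.add_apply] at h1
      linarith
  · rintro x ⟨hxR, hxr⟩
    have hxR' : ‖x - y‖ ≤ R := mem_closedBall_iff_norm.1 hxR
    have hxr' : r ≤ ‖x - y‖ := by simpa [dist_eq_norm] using hxr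
    rcases hxR'.eq_or_lt with heq | hlt
    · left
      simp only [Pi.add_apply, heq, hG, sub_self, mul_zero, add_zero]
      exact hnn x hxR
    rcases hxr'.eq_or_lt with heq | hgt
    · left
      have h1 : m < w x := hball _ (mem_closedBall_iff_norm.2 heq.ge)
      have h2 : Real.exp (-a * ‖x - y‖ ^ 2) ≤ 1 :=
        Real.exp_le_one_iff.2 (by nlinarith [sq_nonneg ‖x - y‖])
      have h3 := mul_le_mul_of_nonneg_left h2 hmpos.le
      have h4 := mul_pos hmpos (Real.exp_pos (-a * R ^ 2))
      simp only [Pi.add_apply, hG, mul_sub]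
      linarith
    · right
      refine ⟨?_, (hw.add hGc).contDiffAt, ?_⟩
      · have hopen : IsOpen (ball y R \ closedBall y r) := isOpen_ball.sdiff isClosed_closedBall
        refine mem_of_superset (hopen.mem_nhds ⟨mem_ball_iff_norm.2 hlt, ?_⟩)
          (sdiff_le_sdiff ball_subset_closedBall ball_subset_closedBall)
        simpa [dist_eq_norm] using hgt
      · rw [hw.contDiffAt.laplacian_add hGc.contDiffAt,
          laplacian_comp_norm_sq y x hGd.contDiffAt, hG2, hG1]
        have h1 := hlap x (mem_ball_iff_norm.2 hlt)
        have h2 : 0 < m * a * Real.exp (-a * ‖x - y‖ ^ 2) := by positivity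
        have h3 : r ^ 2 ≤ ‖x - y‖ ^ 2 := pow_le_pow_left₀ hr.le hxr' 2
        have h4 : (Module.finrank ℝ E : ℝ) + 1 ≤ 2 * a * ‖x - y‖ ^ 2 := by
          rw [← har]
          exact mul_le_mul_of_nonneg_left h3 (by positivity)
        nlinarith

/-- Strong minimum principle for superharmonic functions. -/
lemma pos_of_laplacian_nonpos {U : Set E} (hU : IsOpen U) (hUc : IsPreconnected U) {w : E → ℝ}
    (hw : ContDiff ℝ 2 w) (hnn : ∀ x ∈ U, 0 ≤ w x) (hlap : ∀ x ∈ U, Δ w x ≤ 0)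
    {x₀ : E} (hx₀ : x₀ ∈ U) (hpos : 0 < w x₀) : ∀ x ∈ U, 0 < w x := by
  have hV : IsOpen (U ∩ {x | 0 < w x}) := hU.inter (isOpen_lt continuous_const hw.continuous)
  have := hUc.subset_of_closure_inter_subset hV ⟨x₀, hx₀, hx₀, hpos⟩ ?_
  · exact fun x hx => (this hx).2
  rintro x ⟨hxc, hxU⟩
  refine ⟨hxU, ?_⟩
  obtain ⟨ρ, hρ, hball⟩ := Metric.isOpen_iff.1 hU x hxU
  obtain ⟨y, hy, hxy⟩ := Metric.mem_closure_iff.1 hxc (ρ / 2) (half_pos hρ)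
  have hsub : closedBall y (ρ / 2) ⊆ U := by
    refine Subset.trans (fun z hz => ?_) hball
    have h1 := mem_closedBall.1 hz
    have h2 := dist_triangle z y x
    rw [dist_comm y x] at h2
    exact mem_ball.2 (by linarith)
  exact pos_of_laplacian_nonpos_ball hw (fun z hz => hnn z (hsub hz))
    (fun z hz => hlap z (hsub (ball_subset_closedBall hz))) hy.2 x (mem_ball.2 hxy)

end

section

variable {E : Type*} [NormedAddCommGroup E] [InnerProductSpace ℝ E]

/-- Reflection in the hyperplane `{x | ⟪x, e⟫ = l}`, for a unit vector `e`. -/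
def planeReflection (e : E) (l : ℝ) (x : E) : E := x + (2 * (l - ⟪x, e⟫_ℝ)) • e

lemma planeReflection_eq_reflection_add (e : E) (he : ‖e‖ = 1) (l : ℝ) (x : E) :
    planeReflection e l x = (ℝ ∙ e)ᗮ.reflection x + (2 * l) • e := by
  rw [Submodule.reflection_orthogonal_apply, Submodule.reflection_singleton_apply, planeReflection]
  simp only [he, RCLike.ofReal_real_eq_id, id, one_pow, div_one, mul_sub, sub_smul, mul_smul,
    real_inner_comm x e, ofNat_smul_eq_nsmul]
  abel

lemma continuous_planeReflection (e : E) :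
    Continuous fun q : ℝ × E => planeReflection e q.1 q.2 := by
  unfold planeReflection
  fun_prop

lemma contDiff_planeReflection (e : E) (l : ℝ) : ContDiff ℝ 2 (planeReflection e l) :=
  contDiff_id.add ((contDiff_const.mul
    (contDiff_const.sub (contDiff_id.inner ℝ contDiff_const))).smul contDiff_const)

lemma norm_planeReflection_sq (e : E) (he : ‖e‖ = 1) (l : ℝ) (x : E) :
    ‖planeReflection e l x‖ ^ 2 = ‖x‖ ^ 2 - 4 * l * (⟪x, e⟫_ℝ - l) := by
  rw [planeReflection, norm_add_sq_real, inner_smul_right, norm_smul, mul_pow, Real.norm_eq_abs,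
    sq_abs, he]
  ring

lemma planeReflection_of_inner_eq {e x : E} {l : ℝ} (h : ⟪x, e⟫_ℝ = l) :
    planeReflection e l x = x := by
  simp [planeReflection, h]

lemma norm_planeReflection_lt {e : E} (he : ‖e‖ = 1) {l : ℝ} (hl : 0 < l) {x : E}
    (h : l < ⟪x, e⟫_ℝ) : ‖planeReflection e l x‖ < ‖x‖ := by
  have h1 := norm_planeReflection_sq e he l x
  have h2 : 0 < 4 * l * (⟪x, e⟫_ℝ - l) := mul_pos (by linarith) (by linarith)
  exact lt_of_pow_lt_pow_left₀ 2 (norm_nonneg _) (by linarith)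

variable [FiniteDimensional ℝ E]

/-- `u` is a positive solution of `-Δu = f(u)` in the unit ball, vanishing on the unit sphere. -/
structure IsBallSolution (f : ℝ → ℝ) (u : E → ℝ) : Prop where
  contDiff : ContDiff ℝ 2 u
  laplacian_eq : ∀ x, ‖x‖ < 1 → Δ u x = -f (u x)
  pos : ∀ x, ‖x‖ < 1 → 0 < u x
  zero : ∀ x, ‖x‖ = 1 → u x = 0

namespace IsBallSolution

variable {f : ℝ → ℝ} {u : E → ℝ}

lemma nonneg (hu : IsBallSolution f u) {x : E} (hx : ‖x‖ ≤ 1) : 0 ≤ u x := by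
  rcases hx.eq_or_lt with h | h
  · exact (hu.zero x h).ge
  · exact (hu.pos x h).le

lemma contDiff_comp_planeReflection (hu : IsBallSolution f u) (e : E) (l : ℝ) :
    ContDiff ℝ 2 (fun x => u (planeReflection e l x)) :=
  hu.contDiff.comp (contDiff_planeReflection e l)

lemma laplacian_planeReflection_sub (hu : IsBallSolution f u) {e : E} (he : ‖e‖ = 1) {l : ℝ}
    {x : E} (hx : ‖x‖ < 1) (hσ : ‖planeReflection e l x‖ < 1) :
    Δ ((fun x => u (planeReflection e l x)) - u) x =
      f (u x) - f (u (planeReflection e l x)) := by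
  rw [(hu.contDiff_comp_planeReflection e l).contDiffAt.laplacian_sub hu.contDiff.contDiffAt,
    hu.laplacian_eq x hx]
  have h1 : Δ (fun x => u (planeReflection e l x)) x = Δ u (planeReflection e l x) := by
    simp only [planeReflection_eq_reflection_add e he]
    exact laplacian_comp_isometry _ _ _ hu.contDiff.contDiffAt
  rw [h1, hu.laplacian_eq _ hσ]
  ring

lemma lt_planeReflection (hu : IsBallSolution f u) (hf : MonotoneOn f (Ici 0)) {e : E}
    (he : ‖e‖ = 1) {l : ℝ} (hl : 0 < l)
    (h : ∀ x, ‖x‖ ≤ 1 → l < ⟪x, e⟫_ℝ → u x ≤ u (planeReflection e l x))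
    {x : E} (hx : ‖x‖ ≤ 1) (hlx : l < ⟪x, e⟫_ℝ) : u x < u (planeReflection e l x) := by
  have hsphere : ∀ y, ‖y‖ = 1 → l < ⟪y, e⟫_ℝ → u y < u (planeReflection e l y) := by
    intro y hy hly
    rw [hu.zero y hy]
    exact hu.pos _ ((norm_planeReflection_lt he hl hly).trans_le hy.le)
  rcases hx.eq_or_lt with hx1 | hx1
  · exact hsphere x hx1 hlx
  set w : E → ℝ := (fun x => u (planeReflection e l x)) - u with hw
  have hwd : ContDiff ℝ 2 w := (hu.contDiff_comp_planeReflection e l).sub hu.contDiff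
  set U : Set E := {y | ‖y‖ < 1} ∩ {y | l < ⟪y, e⟫_ℝ} with hUdef
  have hU : IsOpen U := (isOpen_lt continuous_norm continuous_const).inter
    (isOpen_lt continuous_const (by fun_prop))
  have hUc : IsPreconnected U := by
    refine Convex.isPreconnected (Convex.inter ?_ ?_)
    · simpa [ball, dist_eq_norm] using convex_ball (0 : E) 1
    · refine convex_halfSpace_gt (IsLinearMap.mk (fun a b => ?_) fun a b => ?_) l
      · exact inner_add_left _ _ _
      · simp [inner_smul_left]
  have hl1 : l < 1 := by
    have := real_inner_le_norm x e
    rw [he, mul_one] at this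
    linarith
  obtain ⟨x₀, hx₀, hpos⟩ : ∃ x₀ ∈ U, 0 < w x₀ := by
    have hwe : 0 < w e := sub_pos.2 (hsphere e he (by simpa [he] using hl1))
    have hev : ∀ᶠ s : ℝ in 𝓝 1, 0 < w (s • e) ∧ l < s ∧ 0 < s := by
      have hc : Continuous fun s : ℝ => w (s • e) :=
        hwd.continuous.comp (by fun_prop)
      have h1 : ∀ᶠ s : ℝ in 𝓝 1, 0 < w (s • e) :=
        hc.continuousAt.eventually (lt_mem_nhds (by simpa using hwe))
      exact h1.and ((lt_mem_nhds hl1).and (lt_mem_nhds one_pos))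
    obtain ⟨s, ⟨h1, h2, h3⟩, h4⟩ :=
      ((hev.filter_mono nhdsWithin_le_nhds).and (self_mem_nhdsWithin (s := Iio (1 : ℝ)))).exists
    refine ⟨s • e, ⟨?_, ?_⟩, h1⟩
    · simpa [norm_smul, he, abs_of_pos h3] using h4
    · simpa [inner_smul_left, he] using h2
  have key := pos_of_laplacian_nonpos hU hUc hwd
    (fun y hy => sub_nonneg.2 (h y hy.1.le hy.2)) (fun y hy => ?_) hx₀ hpos x ⟨hx1, hlx⟩
  · exact sub_pos.1 key
  · have hσ := (norm_planeReflection_lt he hl hy.2).trans hy.1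
    rw [hu.laplacian_planeReflection_sub he hy.1 hσ]
    exact sub_nonpos.2 (hf (hu.pos _ hy.1).le (hu.pos _ hσ).le (h y hy.1.le hy.2))

lemma eventually_le_planeReflection (hu : IsBallSolution f u) (hf : MonotoneOn f (Ici 0))
    {M C : ℝ} (hM : ∀ x, ‖x‖ ≤ 1 → u x ≤ M) (hC : 0 < C)
    (hfC : ∀ a b, 0 ≤ a → a ≤ b → b ≤ M → f b - f a ≤ C * (b - a)) {e : E}
    (he : ‖e‖ = 1) {l : ℝ} (hl : 0 < l)
    (h : ∀ x, ‖x‖ ≤ 1 → l < ⟪x, e⟫_ℝ → u x ≤ u (planeReflection e l x)) :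
    ∀ᶠ μ in 𝓝 l, μ ≤ l →
      ∀ x, ‖x‖ ≤ 1 → μ < ⟪x, e⟫_ℝ → u x ≤ u (planeReflection e μ x) := by
  obtain ⟨d, hd, hCd⟩ : ∃ d : ℝ, 0 < d ∧ C * (2 * d) ^ 2 < 1 := by
    have hc : Continuous fun d : ℝ => C * (2 * d) ^ 2 := by fun_prop
    have h1 : ∀ᶠ d : ℝ in 𝓝 0, C * (2 * d) ^ 2 < 1 :=
      hc.continuousAt.eventually (gt_mem_nhds (by simp))
    obtain ⟨d, h2, h3⟩ :=
      ((h1.filter_mono nhdsWithin_le_nhds).and (self_mem_nhdsWithin (s := Ioi (0 : ℝ)))).exists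
    exact ⟨d, h3, h2⟩
  have hinner : Continuous fun x : E => ⟪x, e⟫_ℝ := by fun_prop
  have hball : IsCompact {x : E | ‖x‖ ≤ 1} := by
    simpa [closedBall, dist_eq_norm] using isCompact_closedBall (0 : E) 1
  have hK : IsCompact ({x : E | ‖x‖ ≤ 1} ∩ {x | l + d ≤ ⟪x, e⟫_ℝ}) :=
    hball.inter_right (isClosed_le continuous_const hinner)
  have hfar : ∀ᶠ μ in 𝓝 l, ∀ x ∈ {x : E | ‖x‖ ≤ 1} ∩ {x | l + d ≤ ⟪x, e⟫_ℝ},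
      u x < u (planeReflection e μ x) := by
    refine hK.eventually_forall_of_forall_eventually fun x hx => ?_
    have hx2 : l + d ≤ ⟪x, e⟫_ℝ := hx.2
    have hlt := hu.lt_planeReflection hf he hl h hx.1 (by linarith)
    exact (isOpen_lt (hu.contDiff.continuous.comp continuous_snd)
      (hu.contDiff.continuous.comp (continuous_planeReflection e))).mem_nhds hlt
  filter_upwards [hfar, lt_mem_nhds hl, lt_mem_nhds (sub_lt_self l hd)] with μ hμ hμ0 hμd hμl
  set w : E → ℝ := (fun x => u (planeReflection e μ x)) - u with hw
  have hwd : ContDiff ℝ 2 w := (hu.contDiff_comp_planeReflection e μ).sub hu.contDiff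
  have hK' : IsCompact ({x : E | ‖x‖ ≤ 1} ∩ ({x | μ ≤ ⟪x, e⟫_ℝ} ∩ {x | ⟪x, e⟫_ℝ ≤ l + d})) :=
    hball.inter_right ((isClosed_le continuous_const hinner).inter
      (isClosed_le hinner continuous_const))
  intro x hx hμx
  rcases le_total (l + d) ⟪x, e⟫_ℝ with hfarx | hnear
  · exact (hμ x ⟨hx, hfarx⟩).le
  refine sub_nonneg.1 (nonneg_of_laplacian_le_of_narrow hK' hwd he hC hCd (l := μ)
    (fun y hy => ⟨hy.2.1, ?_⟩) (fun y hy => ?_) x ⟨hx, hμx.le, hnear⟩)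
  · have : ⟪y, e⟫_ℝ ≤ l + d := hy.2.2
    linarith
  obtain ⟨hy1, hy2, hy3⟩ := hy
  rcases (show μ ≤ ⟪y, e⟫_ℝ from hy2).eq_or_lt with h2 | h2
  · left
    simp [hw, planeReflection_of_inner_eq h2.symm]
  have hσ := norm_planeReflection_lt he hμ0 h2
  rcases (show ‖y‖ ≤ 1 from hy1).eq_or_lt with h1 | h1
  · left
    simp only [hw, Pi.sub_apply, hu.zero y h1, sub_zero]
    exact (hu.pos _ (hσ.trans_le h1.le)).le
  rcases (show ⟪y, e⟫_ℝ ≤ l + d from hy3).eq_or_lt with h3 | h3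
  · left
    exact sub_nonneg.2 (hμ y ⟨hy1, h3.ge⟩).le
  rcases le_or_gt 0 (w y) with h0 | h0
  · exact Or.inl h0
  right
  constructor
  · have hopen : IsOpen ({x : E | ‖x‖ < 1} ∩ ({x | μ < ⟪x, e⟫_ℝ} ∩ {x | ⟪x, e⟫_ℝ < l + d})) :=
      (isOpen_lt continuous_norm continuous_const).inter
        ((isOpen_lt continuous_const hinner).inter (isOpen_lt hinner continuous_const))
    exact mem_of_superset (hopen.mem_nhds ⟨h1, h2, h3⟩)
      fun z hz => ⟨(show ‖z‖ < 1 from hz.1).le, (show μ < ⟪z, e⟫_ℝ from hz.2.1).le,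
        (show ⟪z, e⟫_ℝ < l + d from hz.2.2).le⟩
  · rw [hu.laplacian_planeReflection_sub he h1 (hσ.trans h1)]
    have := hfC (u (planeReflection e μ y)) (u y) (hu.pos _ (hσ.trans h1)).le
      (sub_neg.1 h0).le (hM y h1.le)
    refine this.trans_eq ?_
    simp only [hw, Pi.sub_apply]
    ring

lemma le_planeReflection_zero (hu : IsBallSolution f u) (hf : MonotoneOn f (Ici 0))
    {M C : ℝ} (hM : ∀ x, ‖x‖ ≤ 1 → u x ≤ M) (hC : 0 < C)
    (hfC : ∀ a b, 0 ≤ a → a ≤ b → b ≤ M → f b - f a ≤ C * (b - a)) {e : E}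
    (he : ‖e‖ = 1) {x : E} (hx : ‖x‖ ≤ 1) (h0x : 0 < ⟪x, e⟫_ℝ) :
    u x ≤ u (planeReflection e 0 x) := by
  set s : Set ℝ := {t | ∀ x, ‖x‖ ≤ 1 → 1 - t < ⟪x, e⟫_ℝ → u x ≤ u (planeReflection e (1 - t) x)}
    with hs
  have hclosed : IsClosed s := by
    simp only [hs, ofPred_forall]
    refine isClosed_iInter fun x => isClosed_iInter fun hx => ?_
    have hc : Continuous fun t : ℝ => u (planeReflection e (1 - t) x) :=
      hu.contDiff.continuous.comp ((continuous_planeReflection e).comp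
        ((continuous_const.sub continuous_id).prodMk continuous_const))
    have heq : {t | 1 - t < ⟪x, e⟫_ℝ → u x ≤ u (planeReflection e (1 - t) x)} =
        {t : ℝ | ⟪x, e⟫_ℝ ≤ 1 - t} ∪ {t | u x ≤ u (planeReflection e (1 - t) x)} := by
      ext t
      simp [imp_iff_not_or]
    rw [heq]
    exact (isClosed_le continuous_const (by fun_prop)).union (isClosed_le continuous_const hc)
  have hsub : Icc (0 : ℝ) 1 ⊆ s := by
    refine (hclosed.inter isClosed_Icc).Icc_subset_of_forall_exists_gt ?_ ?_
    · intro y hy hlt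
      have := real_inner_le_norm y e
      rw [he, mul_one] at this
      linarith
    · rintro t ⟨hts, ht0, ht1⟩ y hy
      have hev := hu.eventually_le_planeReflection hf hM hC hfC he (sub_pos.2 ht1) hts
      have hten : Tendsto (fun t' : ℝ => 1 - t') (𝓝[>] t) (𝓝 (1 - t)) :=
        ((continuous_const.sub continuous_id).tendsto t).mono_left nhdsWithin_le_nhds
      obtain ⟨t', h1, h2, h3⟩ := ((hten.eventually hev).and (Ioc_mem_nhdsGT hy)).exists
      exact ⟨t', h1 (by linarith), h2, h3⟩
  have := hsub (right_mem_Icc.2 zero_le_one) x hx (by simpa using h0x)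
  simpa using this

/-- Radial symmetry of positive solutions, by the method of moving planes. -/
theorem eq_of_norm_eq (hu : IsBallSolution f u) (hf : MonotoneOn f (Ici 0))
    {M C : ℝ} (hM : ∀ x, ‖x‖ ≤ 1 → u x ≤ M) (hC : 0 < C)
    (hfC : ∀ a b, 0 ≤ a → a ≤ b → b ≤ M → f b - f a ≤ C * (b - a))
    {x y : E} (hx : ‖x‖ ≤ 1) (hxy : ‖x‖ = ‖y‖) : u x = u y := by
  have key : ∀ x y : E, ‖x‖ ≤ 1 → ‖x‖ = ‖y‖ → u x ≤ u y := by
    intro x y hx hxy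
    rcases eq_or_ne x y with rfl | hne
    · exact le_rfl
    have hn : 0 < ‖x - y‖ := norm_pos_iff.2 (sub_ne_zero.2 hne)
    have hsq : ‖x - y‖ ^ 2 = 2 * ⟪x, x - y⟫_ℝ := by
      rw [norm_sub_sq_real, inner_sub_right, real_inner_self_eq_norm_sq, hxy]
      ring
    have he : ‖(‖x - y‖⁻¹ : ℝ) • (x - y)‖ = 1 := by
      rw [norm_smul, norm_inv, norm_norm, inv_mul_cancel₀ hn.ne']
    have hin : ⟪x, (‖x - y‖⁻¹ : ℝ) • (x - y)⟫_ℝ = ‖x - y‖ / 2 := by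
      rw [inner_smul_right]
      field_simp
      linarith
    have h := hu.le_planeReflection_zero hf hM hC hfC he hx (by rw [hin]; positivity)
    have hr : planeReflection ((‖x - y‖⁻¹ : ℝ) • (x - y)) 0 x = y := by
      rw [planeReflection, hin, smul_smul]
      have : 2 * (0 - ‖x - y‖ / 2) * ‖x - y‖⁻¹ = -1 := by
        field_simp
        ring
      rw [this]
      simp
    rwa [hr] at h
  exact le_antisymm (key x y hx hxy) (key y x (hxy ▸ hx) hxy.symm)

end IsBallSolution

end

section

lemma rpow_sub_rpow_le {p M : ℝ} (hp : 1 < p) {a b : ℝ} (ha : 0 ≤ a) (hab : a ≤ b) (hb : b ≤ M) :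
    b ^ p - a ^ p ≤ p * M ^ (p - 1) * (b - a) := by
  have hd : ∀ x : ℝ, HasDerivAt (fun x : ℝ => x ^ p) (p * x ^ (p - 1)) x := fun x =>
    Real.hasDerivAt_rpow_const (Or.inr hp.le)
  refine Convex.image_sub_le_mul_sub_of_deriv_le (convex_Icc a b)
    (fun x _ => (hd x).continuousAt.continuousWithinAt)
    (fun x _ => (hd x).differentiableAt.differentiableWithinAt) (fun x hx => ?_)
    a (left_mem_Icc.2 hab) b (right_mem_Icc.2 hab) hab
  have hx' := interior_subset hx
  rw [(hd x).deriv]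
  have h0 : 0 ≤ x := ha.trans hx'.1
  have := Real.rpow_le_rpow h0 (hx'.2.trans hb) (sub_nonneg.2 hp.le)
  exact mul_le_mul_of_nonneg_left this (by linarith)

lemma ContDiff.hasDerivAt_deriv {φ : ℝ → ℝ} (h : ContDiff ℝ 2 φ) (r : ℝ) :
    HasDerivAt (deriv φ) (deriv (deriv φ) r) r := by
  have h1 : ContDiff ℝ 1 (deriv φ) := h.deriv' (n := 1)
  exact ((h1.differentiable (by simp)) r).hasDerivAt

lemma ContDiff.hasDerivAt_of_two {φ : ℝ → ℝ} (h : ContDiff ℝ 2 φ) (r : ℝ) :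
    HasDerivAt φ (deriv φ r) r :=
  ((h.differentiable (by simp)) r).hasDerivAt

/-- Uniqueness for the singular radial initial value problem with zero initial slope. -/
lemma eqOn_of_radial_ode {c L : ℝ} (hc : 0 ≤ c) (hL : 0 ≤ L) {f φ ψ : ℝ → ℝ}
    (hφ : ContDiff ℝ 2 φ) (hψ : ContDiff ℝ 2 ψ)
    (hφo : ∀ r ∈ Ioo (0 : ℝ) 1, r * deriv (deriv φ) r + c * deriv φ r = -(r * f (φ r)))
    (hψo : ∀ r ∈ Ioo (0 : ℝ) 1, r * deriv (deriv ψ) r + c * deriv ψ r = -(r * f (ψ r)))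
    (hf : ∀ r ∈ Ioo (0 : ℝ) 1, |f (φ r) - f (ψ r)| ≤ L * |φ r - ψ r|)
    (h0 : φ 0 = ψ 0) (h0' : deriv φ 0 = deriv ψ 0) : EqOn φ ψ (Icc 0 1) := by
  set D : ℝ → ℝ := fun r =>
    ((φ r - ψ r) ^ 2 + (deriv φ r - deriv ψ r) ^ 2) * Real.exp (-(1 + L) * r) with hD
  have hd : ∀ r, HasDerivAt D
      ((2 * (φ r - ψ r) * (deriv φ r - deriv ψ r)
        + 2 * (deriv φ r - deriv ψ r) * (deriv (deriv φ) r - deriv (deriv ψ) r)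
        - (1 + L) * ((φ r - ψ r) ^ 2 + (deriv φ r - deriv ψ r) ^ 2))
          * Real.exp (-(1 + L) * r)) r := by
    intro r
    have h1 := ((hφ.hasDerivAt_of_two r).sub (hψ.hasDerivAt_of_two r)).pow 2
    have h2 := ((hφ.hasDerivAt_deriv r).sub (hψ.hasDerivAt_deriv r)).pow 2
    have h3 := ((hasDerivAt_id r).const_mul (-(1 + L))).exp
    refine ((h1.add h2).mul h3).congr_deriv ?_
    simp
    ring
  have hanti : AntitoneOn D (Icc 0 1) := by
    refine antitoneOn_of_deriv_nonpos (convex_Icc 0 1)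
      (fun r _ => (hd r).continuousAt.continuousWithinAt)
      (fun r _ => (hd r).differentiableAt.differentiableWithinAt) fun r hr => ?_
    rw [interior_Icc] at hr
    rw [(hd r).deriv]
    refine mul_nonpos_of_nonpos_of_nonneg ?_ (Real.exp_pos _).le
    have h1 := hφo r hr
    have h2 := hψo r hr
    have h3 := hf r hr
    set a := φ r - ψ r
    set b := deriv φ r - deriv ψ r with hb
    set F := f (φ r) - f (ψ r) with hF
    have hr0 : 0 < r := hr.1
    have h4 : deriv (deriv φ) r - deriv (deriv ψ) r = -(c / r * b) - F := by
      field_simp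
      rw [hb, hF]
      linarith
    rw [h4]
    have h5 : 0 ≤ c / r * b ^ 2 := by positivity
    have h6 : -(b * F) ≤ |b| * (L * |a|) := by
      refine (neg_le_abs _).trans ?_
      rw [abs_mul]
      exact mul_le_mul_of_nonneg_left h3 (abs_nonneg b)
    have h7 : 0 ≤ L * (|a| - |b|) ^ 2 := by positivity
    have h8 : |a| ^ 2 = a ^ 2 := sq_abs a
    have h9 : |b| ^ 2 = b ^ 2 := sq_abs b
    nlinarith [sq_nonneg (a - b)]
  intro r hr
  have h1 := hanti (left_mem_Icc.2 zero_le_one) hr hr.1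
  have h2 : D 0 = 0 := by simp [hD, h0, h0']
  have h3 : D r ≤ 0 := h1.trans h2.le
  have h4 : (φ r - ψ r) ^ 2 + (deriv φ r - deriv ψ r) ^ 2 ≤ 0 :=
    nonpos_of_mul_nonpos_left h3 (Real.exp_pos _)
  have h5 : (φ r - ψ r) ^ 2 = 0 := by nlinarith [sq_nonneg (φ r - ψ r), sq_nonneg (deriv φ r - deriv ψ r)]
  exact sub_eq_zero.1 (pow_eq_zero_iff two_ne_zero |>.1 h5)

/-- Radial profiles of positive solutions of the Emden problem in the unit ball, with
`c = N - 1`. -/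
structure IsEmdenProfile (c p : ℝ) (φ : ℝ → ℝ) : Prop where
  contDiff : ContDiff ℝ 2 φ
  deriv_zero : deriv φ 0 = 0
  ode : ∀ r ∈ Ioo (0 : ℝ) 1, r * deriv (deriv φ) r + c * deriv φ r = -(r * φ r ^ p)
  pos : ∀ r ∈ Ico (0 : ℝ) 1, 0 < φ r
  one : φ 1 = 0

lemma IsEmdenProfile.eqOn_of_le {c p : ℝ} (hc : 0 ≤ c) (hp : 1 < p) {φ ψ : ℝ → ℝ}
    (hφ : IsEmdenProfile c p φ) (hψ : IsEmdenProfile c p ψ) (hle : φ 0 ≤ ψ 0) :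
    EqOn φ ψ (Icc 0 1) := by
  have hφ0 := hφ.pos 0 (by simp)
  have hψ0 := hψ.pos 0 (by simp)
  set k := φ 0 / ψ 0 with hk
  have hk0 : 0 < k := div_pos hφ0 hψ0
  have hk1 : k ≤ 1 := (div_le_one hψ0).2 hle
  set t := k ^ ((p - 1) / 2) with ht
  have ht0 : 0 < t := Real.rpow_pos_of_pos hk0 _
  have ht1 : t ≤ 1 := Real.rpow_le_one hk0.le hk1 (by linarith)
  have htk : k * t ^ 2 = k ^ p := by
    rw [ht, ← Real.rpow_natCast, ← Real.rpow_mul hk0.le]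
    nth_rw 1 [← Real.rpow_one k]
    rw [← Real.rpow_add hk0]
    congr 1
    push_cast
    ring
  set χ : ℝ → ℝ := fun r => k * ψ (t * r) with hχ
  have hlin : ∀ r, HasDerivAt (fun r : ℝ => t * r) t r := fun r => by
    simpa using (hasDerivAt_id r).const_mul t
  have hχd : ContDiff ℝ 2 χ := contDiff_const.mul (hψ.contDiff.comp (contDiff_const.mul contDiff_id))
  have hχ1 : deriv χ = fun r => k * t * deriv ψ (t * r) := by
    funext r
    refine (((hψ.contDiff.hasDerivAt_of_two (t * r)).comp r (hlin r)).const_mul k).deriv.trans ?_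
    ring
  have hχ2 : ∀ r, deriv (deriv χ) r = k * t ^ 2 * deriv (deriv ψ) (t * r) := by
    intro r
    rw [hχ1]
    refine (((hψ.contDiff.hasDerivAt_deriv (t * r)).comp r (hlin r)).const_mul (k * t)).deriv.trans ?_
    ring
  have htr : ∀ r ∈ Ioo (0 : ℝ) 1, t * r ∈ Ioo (0 : ℝ) 1 := fun r hr =>
    ⟨mul_pos ht0 hr.1, (mul_le_of_le_one_left hr.1.le ht1).trans_lt hr.2⟩
  have hχpos : ∀ r ∈ Ioo (0 : ℝ) 1, 0 < χ r := fun r hr =>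
    mul_pos hk0 (hψ.pos _ (Ioo_subset_Ico_self (htr r hr)))
  obtain ⟨M₁, hM₁⟩ := isCompact_Icc.bddAbove_image (hφ.contDiff.continuous.continuousOn (s := Icc 0 1))
  obtain ⟨M₂, hM₂⟩ := isCompact_Icc.bddAbove_image (hχd.continuous.continuousOn (s := Icc 0 1))
  have heq : EqOn φ χ (Icc 0 1) := by
    refine eqOn_of_radial_ode (f := fun x => x ^ p) (L := p * (max M₁ M₂) ^ (p - 1)) hc
      (mul_nonneg (by linarith) (Real.rpow_nonneg (hφ0.le.trans
        ((hM₁ ⟨0, left_mem_Icc.2 zero_le_one, rfl⟩).trans (le_max_left _ _))) _))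
      hφ.contDiff hχd hφ.ode (fun r hr => ?_) (fun r hr => ?_) ?_ ?_
    · have h1 := hψ.ode (t * r) (htr r hr)
      have h2 : χ r ^ p = k ^ p * ψ (t * r) ^ p :=
        Real.mul_rpow hk0.le (hψ.pos _ (Ioo_subset_Ico_self (htr r hr))).le
      rw [hχ2, hχ1, h2, ← htk]
      linear_combination k * t * h1
    · have hrI := Ioo_subset_Icc_self hr
      have h1 : φ r ≤ max M₁ M₂ := (hM₁ ⟨r, hrI, rfl⟩).trans (le_max_left _ _)
      have h2 : χ r ≤ max M₁ M₂ := (hM₂ ⟨r, hrI, rfl⟩).trans (le_max_right _ _)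
      have h3 := (hφ.pos r (Ioo_subset_Ico_self hr)).le
      have h4 := (hχpos r hr).le
      rcases le_total (φ r) (χ r) with h | h
      · rw [abs_sub_comm, abs_sub_comm (φ r), abs_of_nonneg (sub_nonneg.2 h), abs_of_nonneg]
        · exact rpow_sub_rpow_le hp h3 h h2
        · exact sub_nonneg.2 (Real.rpow_le_rpow h3 h (by linarith))
      · rw [abs_of_nonneg (sub_nonneg.2 h), abs_of_nonneg]
        · exact rpow_sub_rpow_le hp h4 h h1
        · exact sub_nonneg.2 (Real.rpow_le_rpow h4 h (by linarith))
    · simp only [hχ, hk, mul_zero]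
      field_simp
    · simp [hχ1, hψ.deriv_zero, hφ.deriv_zero]
  have ht_eq : t = 1 := by
    refine le_antisymm ht1 (not_lt.1 fun hlt => ?_)
    have h1 := heq (right_mem_Icc.2 zero_le_one)
    have h2 := mul_pos hk0 (hψ.pos t ⟨ht0.le, hlt⟩)
    simp only [hφ.one, hχ, mul_one] at h1
    linarith
  have hk_eq : k = 1 := by
    refine le_antisymm hk1 (not_lt.1 fun hlt => ?_)
    have := Real.rpow_lt_one hk0.le hlt (show 0 < (p - 1) / 2 by linarith)
    linarith
  intro r hr
  rw [heq hr]
  simp [hχ, ht_eq, hk_eq]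

variable {E : Type*} [NormedAddCommGroup E] [InnerProductSpace ℝ E] [FiniteDimensional ℝ E]

lemma IsBallSolution.isEmdenProfile {p : ℝ} {u : E → ℝ}
    (hu : IsBallSolution (fun x => x ^ p) u)
    (hrad : ∀ x y : E, ‖x‖ ≤ 1 → ‖x‖ = ‖y‖ → u x = u y) {e : E} (he : ‖e‖ = 1) :
    IsEmdenProfile (Module.finrank ℝ E - 1) p (fun r => u (r • e)) := by
  have hφ : ContDiff ℝ 2 (fun r : ℝ => u (r • e)) :=
    hu.contDiff.comp (contDiff_id.smul contDiff_const)
  refine ⟨hφ, ?_, fun r hr => ?_, fun r hr => ?_, ?_⟩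
  · have h1 : (fun r : ℝ => u (r • e)) =ᶠ[𝓝 0] fun r => u ((-r) • e) := by
      filter_upwards [Icc_mem_nhds (show (-1 : ℝ) < 0 by norm_num) one_pos] with r hr
      refine hrad _ _ ?_ ?_
      · rw [norm_smul, he, mul_one]
        exact abs_le.2 hr
      · simp [norm_smul]
    have h2 := h1.deriv_eq
    rw [deriv_comp_neg (fun r : ℝ => u (r • e)) 0, neg_zero] at h2
    linarith
  · set φ : ℝ → ℝ := fun r => u (r • e) with hφdef
    set G : ℝ → ℝ := fun ρ => φ (√ρ) with hG
    have hr0 : 0 < r := hr.1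
    have hGd : ∀ s : ℝ, 0 < s → ContDiffAt ℝ 2 G (s ^ 2) := fun s hs =>
      hφ.contDiffAt.comp (s ^ 2) (Real.contDiffAt_sqrt (by positivity))
    have hnr : ‖r • e‖ = r := by rw [norm_smul, he, mul_one, Real.norm_eq_abs, abs_of_pos hr0]
    have h1 : u =ᶠ[𝓝 (r • e)] fun z => G (‖z - 0‖ ^ 2) := by
      have : ∀ᶠ z : E in 𝓝 (r • e), ‖z‖ < 1 :=
        continuous_norm.continuousAt.eventually (gt_mem_nhds
          (show ‖r • e‖ < 1 by rw [hnr]; exact hr.2))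
      filter_upwards [this] with z hz
      simp only [hG, hφdef, sub_zero, Real.sqrt_sq (norm_nonneg z)]
      refine hrad _ _ hz.le ?_
      simp [norm_smul, he]
    have h2 : Δ u (r • e) = 4 * r ^ 2 * deriv (deriv G) (r ^ 2)
        + 2 * Module.finrank ℝ E * deriv G (r ^ 2) := by
      rw [(InnerProductSpace.laplacian_congr_nhds h1).self_of_nhds,
        laplacian_comp_norm_sq 0 (r • e)] <;> rw [sub_zero, hnr]
      exact hGd r hr0
    rw [hu.laplacian_eq _ (by rw [hnr]; exact hr.2)] at h2
    have hsq : ∀ s : ℝ, HasDerivAt (fun s : ℝ => s ^ 2) (2 * s) s := fun s =>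
      (hasDerivAt_pow 2 s).congr_deriv (by simp)
    have h3 : φ =ᶠ[𝓝 r] fun s => G (s ^ 2) := by
      filter_upwards [lt_mem_nhds hr0] with s hs
      simp only [hG, Real.sqrt_sq hs.le]
    have h4 : deriv φ =ᶠ[𝓝 r] fun s => deriv G (s ^ 2) * (2 * s) := by
      filter_upwards [h3.eventuallyEq_nhds, lt_mem_nhds hr0] with s hs hs0
      rw [hs.deriv_eq]
      exact (((hGd s hs0).differentiableAt (by simp)).hasDerivAt.comp
        (h := fun s : ℝ => s ^ 2) s (hsq s)).deriv
    have h5 : HasDerivAt (deriv G) (deriv (deriv G) (r ^ 2)) (r ^ 2) := by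
      have : ContDiffAt ℝ 1 (deriv G) (r ^ 2) := (hGd r hr0).derivWithin (by norm_num)
      exact (this.differentiableAt (by simp)).hasDerivAt
    have h6 : deriv (deriv φ) r =
        deriv (deriv G) (r ^ 2) * (2 * r) * (2 * r) + deriv G (r ^ 2) * 2 := by
      rw [h4.deriv_eq]
      have h7 : HasDerivAt (fun s : ℝ => 2 * s) 2 r := by
        simpa using (hasDerivAt_id r).const_mul (2 : ℝ)
      exact ((h5.comp (h := fun s : ℝ => s ^ 2) r (hsq r)).mul h7).deriv
    rw [h6, h4.self_of_nhds]
    linear_combination (-r) * h2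
  · refine hu.pos _ ?_
    rw [norm_smul, he, mul_one, Real.norm_eq_abs, abs_of_nonneg hr.1]
    exact hr.2
  · exact hu.zero _ (by simpa using he)

/-- Uniqueness of positive solutions of the Emden problem in the unit ball. -/
theorem IsBallSolution.eq_of_rpow {p : ℝ} (hp : 1 < p) {u v : E → ℝ}
    (hu : IsBallSolution (fun x => x ^ p) u) (hv : IsBallSolution (fun x => x ^ p) v)
    {x : E} (hx : ‖x‖ ≤ 1) (hE : 0 < Module.finrank ℝ E) : u x = v x := by
  have hrad : ∀ w : E → ℝ, IsBallSolution (fun x => x ^ p) w →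
      ∀ x y : E, ‖x‖ ≤ 1 → ‖x‖ = ‖y‖ → w x = w y := by
    intro w hw x y hx hxy
    obtain ⟨M, hM⟩ := (isCompact_closedBall (0 : E) 1).bddAbove_image hw.contDiff.continuous.continuousOn
    have hM' : ∀ x, ‖x‖ ≤ 1 → w x ≤ M := fun x hx => hM ⟨x, by simpa using hx, rfl⟩
    have hMpos : 0 < M := (hw.pos 0 (by simp)).trans_le (hM' 0 (by simp))
    exact hw.eq_of_norm_eq (fun a ha b hb hab => Real.rpow_le_rpow ha hab (by linarith)) hM'
      (C := p * M ^ (p - 1)) (mul_pos (by linarith) (Real.rpow_pos_of_pos hMpos _))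
      (fun a b ha hab hb => rpow_sub_rpow_le hp ha hab hb) hx hxy
  have : Nontrivial E := Module.finrank_pos_iff.1 hE
  obtain ⟨e, he⟩ := exists_norm_eq E zero_le_one
  have hc : (0 : ℝ) ≤ Module.finrank ℝ E - 1 := by
    have : (1 : ℝ) ≤ Module.finrank ℝ E := by exact_mod_cast hE
    linarith
  have h1 := hu.isEmdenProfile (hrad u hu) he
  have h2 := hv.isEmdenProfile (hrad v hv) he
  have hmem : ‖x‖ ∈ Icc (0 : ℝ) 1 := ⟨norm_nonneg x, hx⟩
  have hn : ‖x‖ = ‖‖x‖ • e‖ := by simp [norm_smul, he]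
  rw [hrad u hu x _ hx hn, hrad v hv x _ hx hn]
  rcases le_total (u ((0 : ℝ) • e)) (v ((0 : ℝ) • e)) with h | h
  · exact h1.eqOn_of_le hc hp h2 h hmem
  · exact (h2.eqOn_of_le hc hp h1 h hmem).symm

end

section

/-- The weighted mean of `g` over `[0, σ]` which inverts the radial Laplacian, written in the
variable `σ = r ^ 2`. -/
def radialMean (n : ℕ) (g : ℝ → ℝ) (σ : ℝ) : ℝ := ∫ t in (0 : ℝ)..1, t ^ n * g (σ * t ^ 2)

lemma continuous_radialMean (n : ℕ) {g : ℝ → ℝ} (hg : Continuous g) :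
    Continuous (radialMean n g) := by
  unfold radialMean
  refine intervalIntegral.continuous_parametric_intervalIntegral_of_continuous' ?_ 0 1
  fun_prop

lemma intervalIntegrable_radialMean (n : ℕ) {g : ℝ → ℝ} (hg : Continuous g) (σ : ℝ) :
    IntervalIntegrable (fun t : ℝ => t ^ n * g (σ * t ^ 2)) volume 0 1 :=
  Continuous.intervalIntegrable (by fun_prop) _ _

lemma abs_radialMean_sub_le (n : ℕ) {g₁ g₂ : ℝ → ℝ} (hg₁ : Continuous g₁) (hg₂ : Continuous g₂)
    {σ M : ℝ} (hM : ∀ s, |s| ≤ |σ| → |g₁ s - g₂ s| ≤ M) :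
    |radialMean n g₁ σ - radialMean n g₂ σ| ≤ M := by
  unfold radialMean
  rw [← intervalIntegral.integral_sub (intervalIntegrable_radialMean n hg₁ σ)
    (intervalIntegrable_radialMean n hg₂ σ), ← Real.norm_eq_abs]
  have := intervalIntegral.norm_integral_le_of_norm_le_const (a := (0 : ℝ)) (b := 1) (C := M)
    (f := fun t : ℝ => t ^ n * g₁ (σ * t ^ 2) - t ^ n * g₂ (σ * t ^ 2)) ?_
  · simpa using this
  intro t ht
  rw [uIoc_of_le zero_le_one] at ht
  rw [← mul_sub, norm_mul, norm_pow, Real.norm_of_nonneg ht.1.le]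
  have h1 : t ^ n ≤ 1 := pow_le_one₀ ht.1.le ht.2
  have h2 : |g₁ (σ * t ^ 2) - g₂ (σ * t ^ 2)| ≤ M := hM _ (by
    rw [abs_mul, abs_of_nonneg (sq_nonneg t)]
    exact mul_le_of_le_one_right (abs_nonneg _) (pow_le_one₀ ht.1.le ht.2))
  calc t ^ n * ‖g₁ (σ * t ^ 2) - g₂ (σ * t ^ 2)‖ ≤ 1 * M :=
        mul_le_mul h1 h2 (abs_nonneg _) zero_le_one
    _ = M := one_mul M

lemma abs_integral_le_of_abs_le_exp {w : ℝ → ℝ} {C D : ℝ}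
    (h : ∀ s, |w s| ≤ C * (D * Real.exp (C * |s|))) (hD : 0 ≤ D) (ρ : ℝ) :
    |∫ s in (0 : ℝ)..ρ, w s| ≤ D * Real.exp (C * |ρ|) := by
  have h1 : ∫ s in (0 : ℝ)..ρ, w s = ∫ s in (0 : ℝ)..1, ρ * w (ρ * s) := by
    rw [intervalIntegral.integral_const_mul, intervalIntegral.mul_integral_comp_mul_left]
    simp
  have hderiv : ∀ s ∈ uIcc (0 : ℝ) 1, HasDerivAt (fun s => D * Real.exp (C * |ρ| * s))
      (D * (Real.exp (C * |ρ| * s) * (C * |ρ|))) s := fun s _ => by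
    have := (((hasDerivAt_id s).const_mul (C * |ρ|)).exp).const_mul D
    simpa using this
  have h2 := intervalIntegral.integral_eq_sub_of_hasDerivAt hderiv
    (Continuous.intervalIntegrable (by fun_prop) _ _)
  have h3 : ‖∫ s in (0 : ℝ)..1, ρ * w (ρ * s)‖ ≤
      ∫ s in (0 : ℝ)..1, D * (Real.exp (C * |ρ| * s) * (C * |ρ|)) := by
    refine intervalIntegral.norm_integral_le_of_norm_le zero_le_one
      (Eventually.of_forall fun s hs => ?_) (Continuous.intervalIntegrable (by fun_prop) _ _)
    rw [norm_mul, Real.norm_eq_abs, Real.norm_eq_abs]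
    have := mul_le_mul_of_nonneg_left (h (ρ * s)) (abs_nonneg ρ)
    rw [abs_mul, abs_of_pos hs.1, ← mul_assoc C |ρ| s] at this
    refine this.trans_eq ?_
    ring
  rw [h2, ← h1] at h3
  simp only [mul_one, mul_zero, Real.exp_zero, Real.norm_eq_abs] at h3
  linarith

/-- The Picard operator for the radial equation in the variable `σ = r ^ 2`. -/
def radialPicard (n : ℕ) (f F : ℝ → ℝ) (ρ : ℝ) : ℝ :=
  1 - 1 / 2 * ∫ σ in (0 : ℝ)..ρ, radialMean n (fun s => f (F s)) σ

lemma abs_radialPicard_sub_le (n : ℕ) {f F₁ F₂ : ℝ → ℝ} {C D : ℝ} (hC : 0 < C)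
    (hf : ∀ a b, |f a - f b| ≤ C * |a - b|) (hfc : Continuous f) (hF₁ : Continuous F₁)
    (hF₂ : Continuous F₂) (hD : 0 ≤ D) (h : ∀ s, |F₁ s - F₂ s| ≤ D * Real.exp (C * |s|)) (ρ : ℝ) :
    |radialPicard n f F₁ ρ - radialPicard n f F₂ ρ| ≤ 1 / 2 * D * Real.exp (C * |ρ|) := by
  have hc1 : Continuous (radialMean n fun s => f (F₁ s)) :=
    continuous_radialMean n (hfc.comp hF₁)
  have hc2 : Continuous (radialMean n fun s => f (F₂ s)) :=
    continuous_radialMean n (hfc.comp hF₂)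
  have key := abs_integral_le_of_abs_le_exp (D := D)
    (w := fun σ => radialMean n (fun s => f (F₂ s)) σ - radialMean n (fun s => f (F₁ s)) σ)
    (fun σ => abs_radialMean_sub_le n (hfc.comp hF₂) (hfc.comp hF₁) fun s hs =>
      (hf _ _).trans (mul_le_mul_of_nonneg_left (by
        rw [abs_sub_comm]
        refine (h s).trans (mul_le_mul_of_nonneg_left (Real.exp_le_exp.2 ?_) hD)
        exact mul_le_mul_of_nonneg_left hs hC.le) hC.le)) hD ρ
  rw [intervalIntegral.integral_sub (hc2.intervalIntegrable _ _) (hc1.intervalIntegrable _ _)]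
    at key
  unfold radialPicard
  have e : ∀ x y : ℝ, 1 - 1 / 2 * x - (1 - 1 / 2 * y) = 1 / 2 * (y - x) := fun x y => by ring
  rw [e, abs_mul, abs_of_pos (by norm_num : (0 : ℝ) < 1 / 2), mul_assoc]
  exact mul_le_mul_of_nonneg_left key (by norm_num)

lemma continuous_radialPicard (n : ℕ) {f F : ℝ → ℝ} (hf : Continuous f) (hF : Continuous F) :
    Continuous (radialPicard n f F) := by
  have hc := continuous_radialMean n (hf.comp hF)
  exact continuous_const.sub (continuous_const.mul
    (intervalIntegral.continuous_primitive (fun a b => hc.intervalIntegrable a b) 0))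

open BoundedContinuousFunction in
lemma exists_radialPicard_fixedPoint (n : ℕ) {f : ℝ → ℝ} {C : ℝ} (hC : 0 < C)
    (hf : ∀ a b, |f a - f b| ≤ C * |a - b|) (hfc : Continuous f) (hf0 : f 0 = 0) :
    ∃ F : ℝ → ℝ, Continuous F ∧ ∀ ρ, F ρ = radialPicard n f F ρ := by
  let W : (ℝ →ᵇ ℝ) → ℝ → ℝ := fun G ρ => Real.exp (C * |ρ|) * G ρ
  have hW : ∀ G, Continuous (W G) := fun G => by
    have := G.continuous
    fun_prop
  have hWd : ∀ G H s, |W G s - W H s| ≤ dist G H * Real.exp (C * |s|) := fun G H s => by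
    simp only [W]
    rw [← mul_sub, abs_mul, Real.abs_exp, mul_comm]
    exact mul_le_mul_of_nonneg_right (dist_coe_le_dist (f := G) (g := H) s) (Real.exp_pos _).le
  have h0 : ∀ ρ, radialPicard n f (W 0) ρ = 1 := fun ρ => by
    simp [radialPicard, W, hf0, radialMean]
  have hest : ∀ G H ρ, |Real.exp (-(C * |ρ|)) * radialPicard n f (W G) ρ -
      Real.exp (-(C * |ρ|)) * radialPicard n f (W H) ρ| ≤ 1 / 2 * dist G H := fun G H ρ => by
    rw [← mul_sub, abs_mul, Real.abs_exp]
    have := mul_le_mul_of_nonneg_left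
      (abs_radialPicard_sub_le n hC hf hfc (hW G) (hW H) dist_nonneg (hWd G H) ρ)
      (Real.exp_pos (-(C * |ρ|))).le
    refine this.trans_eq ?_
    rw [mul_comm, mul_assoc, ← Real.exp_add]
    simp
  let T : (ℝ →ᵇ ℝ) → (ℝ →ᵇ ℝ) := fun G =>
    BoundedContinuousFunction.ofNormedAddCommGroup
      (fun ρ => Real.exp (-(C * |ρ|)) * radialPicard n f (W G) ρ)
      (by
        have := continuous_radialPicard n hfc (hW G)
        fun_prop) (1 / 2 * dist G 0 + 1) (fun ρ => by
        have h1 := hest G 0 ρ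
        rw [h0, mul_one] at h1
        have h2 : Real.exp (-(C * |ρ|)) ≤ 1 := Real.exp_le_one_iff.2 (by
          have := mul_nonneg hC.le (abs_nonneg ρ)
          linarith)
        have h3 := Real.exp_pos (-(C * |ρ|))
        rw [abs_le] at h1
        rw [Real.norm_eq_abs, abs_le]
        constructor <;> linarith [h1.1, h1.2])
  have hT : ContractingWith (1 / 2) T := by
    refine ⟨by rw [← NNReal.coe_lt_coe]; norm_num, LipschitzWith.of_dist_le_mul fun G H => ?_⟩
    refine (BoundedContinuousFunction.dist_le (by positivity)).2 fun ρ => ?_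
    simpa [T, Real.dist_eq] using hest G H ρ
  obtain ⟨G, hG⟩ : ∃ G, T G = G := ⟨_, hT.fixedPoint_isFixedPt⟩
  refine ⟨W G, hW G, fun ρ => ?_⟩
  have h1 : G ρ = Real.exp (-(C * |ρ|)) * radialPicard n f (W G) ρ := by
    conv_lhs => rw [← hG]
    rfl
  have h2 : W G ρ = Real.exp (C * |ρ|) * G ρ := rfl
  rw [h2, h1, ← mul_assoc, ← Real.exp_add]
  simp

/-- Differentiation under the integral sign for `radialMean`. -/
lemma hasDerivAt_radialMean (n : ℕ) {g g' : ℝ → ℝ} (hg : ∀ x, HasDerivAt g (g' x) x)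
    (hg' : Continuous g') (σ : ℝ) :
    HasDerivAt (radialMean n g) (radialMean (n + 2) g' σ) σ := by
  have hgc : Continuous g := continuous_iff_continuousAt.2 fun x => (hg x).continuousAt
  obtain ⟨M, hM⟩ := (isCompact_Icc (a := -(|σ| + 1)) (b := |σ| + 1)).bddAbove_image
    (hg'.norm.continuousOn)
  refine (intervalIntegral.hasDerivAt_integral_of_dominated_loc_of_deriv_le
    (F := fun x t : ℝ => t ^ n * g (x * t ^ 2)) (F' := fun x t : ℝ => t ^ (n + 2) * g' (x * t ^ 2))
    (bound := fun _ => M) (ball_mem_nhds σ one_pos)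
    (Eventually.of_forall fun x => Continuous.aestronglyMeasurable (by fun_prop))
    (intervalIntegrable_radialMean n hgc σ) (Continuous.aestronglyMeasurable (by fun_prop))
    (Eventually.of_forall fun t ht x hx => ?_) intervalIntegrable_const
    (Eventually.of_forall fun t ht x hx => ?_)).2
  · rw [uIoc_of_le zero_le_one] at ht
    have h1 : t ^ (n + 2) ≤ 1 := pow_le_one₀ ht.1.le ht.2
    have hx' : |x| ≤ |σ| + 1 := by
      have h3 : |x - σ| < 1 := hx
      have h4 := abs_add_le (x - σ) σ
      rw [sub_add_cancel] at h4
      linarith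
    have h2 : ‖g' (x * t ^ 2)‖ ≤ M := hM ⟨x * t ^ 2, abs_le.1 (by
      rw [abs_mul, abs_of_nonneg (sq_nonneg t)]
      exact (mul_le_of_le_one_right (abs_nonneg _) (pow_le_one₀ ht.1.le ht.2)).trans hx'), rfl⟩
    rw [norm_mul, norm_pow, Real.norm_of_nonneg ht.1.le]
    calc _ ≤ 1 * M := mul_le_mul h1 h2 (norm_nonneg _) zero_le_one
      _ = M := one_mul M
  · have := ((hg (x * t ^ 2)).comp x ((hasDerivAt_id x).mul_const (t ^ 2))).const_mul (t ^ n)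
    exact this.congr_deriv (by ring)

lemma radialMean_ode (n : ℕ) {g g' : ℝ → ℝ} (hg : ∀ x, HasDerivAt g (g' x) x)
    (hg' : Continuous g') (σ : ℝ) :
    2 * σ * radialMean (n + 2) g' σ + (n + 1) * radialMean n g σ = g σ := by
  have hgc : Continuous g := continuous_iff_continuousAt.2 fun x => (hg x).continuousAt
  have hd : ∀ t ∈ uIcc (0 : ℝ) 1, HasDerivAt (fun t : ℝ => t ^ (n + 1) * g (σ * t ^ 2))
      (2 * σ * (t ^ (n + 2) * g' (σ * t ^ 2)) + (n + 1) * (t ^ n * g (σ * t ^ 2))) t := by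
    intro t _
    have h1 : HasDerivAt (fun t : ℝ => g (σ * t ^ 2)) (g' (σ * t ^ 2) * (σ * (2 * t))) t := by
      have h2 : HasDerivAt (fun t : ℝ => σ * t ^ 2) (σ * (2 * t)) t :=
        ((hasDerivAt_pow 2 t).const_mul σ).congr_deriv (by norm_num)
      exact HasDerivAt.comp (h := fun t : ℝ => σ * t ^ 2) t (hg (σ * t ^ 2)) h2
    refine ((hasDerivAt_pow (n + 1) t).mul h1).congr_deriv ?_
    push_cast
    ring
  have h1 := intervalIntegral.integral_eq_sub_of_hasDerivAt hd
    (Continuous.intervalIntegrable (by fun_prop) _ _)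
  rw [intervalIntegral.integral_add (Continuous.intervalIntegrable (by fun_prop) _ _)
    (Continuous.intervalIntegrable (by fun_prop) _ _), intervalIntegral.integral_const_mul,
    intervalIntegral.integral_const_mul] at h1
  simpa [radialMean] using h1

/-- Global solutions, with value one at the origin, of the radial equation in the
variable `σ = r ^ 2`. -/
lemma exists_radial_solution (n : ℕ) {f k : ℝ → ℝ} {C : ℝ} (hC : 0 < C)
    (hf : ∀ x, HasDerivAt f (k x) x) (hk : Continuous k) (hkC : ∀ x, |k x| ≤ C) (hf0 : f 0 = 0) :
    ∃ F : ℝ → ℝ, ContDiff ℝ 2 F ∧ F 0 = 1 ∧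
      (∀ σ, deriv F σ = -(1 / 2) * radialMean n (fun s => f (F s)) σ) ∧
      ∀ σ, 4 * σ * deriv (deriv F) σ + 2 * (n + 1) * deriv F σ = -f (F σ) := by
  have hfc : Continuous f := continuous_iff_continuousAt.2 fun x => (hf x).continuousAt
  obtain ⟨F, hF, hfix⟩ := exists_radialPicard_fixedPoint n hC (fun a b => by
    have := Convex.norm_image_sub_le_of_norm_hasDerivWithin_le (s := univ) (C := C)
      (fun x _ => (hf x).hasDerivWithinAt) (fun x _ => hkC x) convex_univ (mem_univ b) (mem_univ a)
    simpa using this) hfc hf0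
  have hm := continuous_radialMean n (hfc.comp hF)
  have hd : ∀ σ, HasDerivAt F (-(1 / 2) * radialMean n (fun s => f (F s)) σ) σ := fun σ => by
    have h1 := (((hm.integral_hasStrictDerivAt 0 σ).hasDerivAt).const_mul (1 / 2)).const_sub 1
    rw [show F = radialPicard n f F from funext hfix]
    refine HasDerivAt.congr_deriv (f' := -(1 / 2 * radialMean n (fun s => f (F s)) σ)) ?_ (by
      rw [← show F = radialPicard n f F from funext hfix]; ring)
    exact h1
  have hF' : deriv F = fun σ => -(1 / 2) * radialMean n (fun s => f (F s)) σ :=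
    funext fun σ => (hd σ).deriv
  have hg : ∀ σ, HasDerivAt (fun s => f (F s))
      (k (F σ) * (-(1 / 2) * radialMean n (fun s => f (F s)) σ)) σ :=
    fun σ => (hf (F σ)).comp σ (hd σ)
  have hg' : Continuous fun σ => k (F σ) * (-(1 / 2) * radialMean n (fun s => f (F s)) σ) :=
    (hk.comp hF).mul (continuous_const.mul hm)
  have hd2 : ∀ σ, HasDerivAt (deriv F) (-(1 / 2) * radialMean (n + 2)
      (fun σ => k (F σ) * (-(1 / 2) * radialMean n (fun s => f (F s)) σ)) σ) σ := fun σ => by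
    rw [hF']
    exact (hasDerivAt_radialMean n hg hg' σ).const_mul _
  have hF'' : deriv (deriv F) = fun σ => -(1 / 2) * radialMean (n + 2)
      (fun σ => k (F σ) * (-(1 / 2) * radialMean n (fun s => f (F s)) σ)) σ :=
    funext fun σ => (hd2 σ).deriv
  refine ⟨F, ?_, ?_, fun σ => (hd σ).deriv, fun σ => ?_⟩
  · rw [show (2 : WithTop ℕ∞) = 1 + 1 by norm_num, contDiff_succ_iff_deriv]
    refine ⟨fun σ => (hd σ).differentiableAt, by simp, ?_⟩
    rw [contDiff_one_iff_deriv]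
    refine ⟨fun σ => (hd2 σ).differentiableAt, ?_⟩
    rw [hF'']
    exact continuous_const.mul (continuous_radialMean (n + 2) hg')
  · rw [hfix]; simp [radialPicard]
  · have := radialMean_ode n hg hg' σ
    rw [hF'', hF']
    simp only
    linarith

end

section

/-- A globally Lipschitz `C¹` nonlinearity which agrees with `w ^ p` on `[0, 1]`. -/
lemma exists_truncated_rpow {p : ℝ} (hp : 1 < p) :
    ∃ f k : ℝ → ℝ, (∀ x, HasDerivAt f (k x) x) ∧ Continuous k ∧ (∀ x, |k x| ≤ p) ∧ f 0 = 0 ∧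
      Monotone f ∧ (∀ x, 0 ≤ f x) ∧ ∀ x ∈ Icc (0 : ℝ) 1, f x = x ^ p := by
  have hp' : 0 < p - 1 := sub_pos.2 hp
  have hp0 : 0 < p := by linarith
  let k : ℝ → ℝ := fun s => p * (max 0 (min s 1)) ^ (p - 1)
  have hk : Continuous k := continuous_const.mul
    ((continuous_const.max (continuous_id.min continuous_const)).rpow_const
      fun _ => Or.inr hp'.le)
  have hk0 : ∀ x, 0 ≤ k x := fun x =>
    mul_nonneg hp0.le (Real.rpow_nonneg (le_max_left _ _) _)
  have hkp : ∀ x, |k x| ≤ p := fun x => by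
    rw [abs_of_nonneg (hk0 x)]
    exact mul_le_of_le_one_right hp0.le (Real.rpow_le_one (le_max_left _ _)
      (max_le zero_le_one (min_le_right _ _)) hp'.le)
  have hf : ∀ x, HasDerivAt (fun w => ∫ s in (0 : ℝ)..w, k s) (k x) x := fun x =>
    (hk.integral_hasStrictDerivAt 0 x).hasDerivAt
  have hmono : Monotone fun w => ∫ s in (0 : ℝ)..w, k s :=
    monotone_of_deriv_nonneg (fun x => (hf x).differentiableAt) fun x => by
      rw [(hf x).deriv]; exact hk0 x
  refine ⟨fun w => ∫ s in (0 : ℝ)..w, k s, k, hf, hk, hkp, by simp, hmono, fun x => ?_,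
    fun x hx => ?_⟩
  · rcases le_total 0 x with h | h
    · simpa using hmono h
    · refine le_of_eq (Eq.symm ?_)
      have : ∫ s in (0 : ℝ)..x, k s = ∫ s in (0 : ℝ)..x, (0 : ℝ) := by
        refine intervalIntegral.integral_congr fun s hs => ?_
        rw [uIcc_of_ge h] at hs
        have h1 : max 0 (min s 1) = 0 := max_eq_left ((min_le_left _ _).trans hs.2)
        simp [k, h1, Real.zero_rpow hp'.ne']
      simpa using this
  · have h1 : ∫ s in (0 : ℝ)..x, k s = ∫ s in (0 : ℝ)..x, p * s ^ (p - 1) := by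
      refine intervalIntegral.integral_congr fun s hs => ?_
      rw [uIcc_of_le hx.1] at hs
      simp only [k]
      rw [min_eq_left (hs.2.trans hx.2), max_eq_right hs.1]
    have h2 := intervalIntegral.integral_eq_sub_of_hasDerivAt (a := 0) (b := x)
      (fun s _ => Real.hasDerivAt_rpow_const (x := s) (p := p) (Or.inr hp.le))
      (Continuous.intervalIntegrable (continuous_const.mul
        (continuous_id.rpow_const fun _ => Or.inr hp'.le)) _ _)
    rw [Real.zero_rpow hp0.ne', sub_zero] at h2
    exact h1.trans h2

lemma radialMean_nonneg (n : ℕ) {g : ℝ → ℝ} (hg : ∀ x, 0 ≤ g x) (σ : ℝ) :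
    0 ≤ radialMean n g σ :=
  intervalIntegral.integral_nonneg zero_le_one fun _ ht => mul_nonneg (pow_nonneg ht.1 n) (hg _)

lemma le_radialMean (n : ℕ) {g : ℝ → ℝ} (hgc : Continuous g) {σ m : ℝ} (hσ : 0 ≤ σ)
    (hm : ∀ s ∈ Icc 0 σ, m ≤ g s) : m / (n + 1) ≤ radialMean n g σ := by
  have h1 : ∫ t in (0 : ℝ)..1, t ^ n * m = m / (n + 1) := by
    rw [intervalIntegral.integral_mul_const, integral_pow]
    simp
    ring
  rw [← h1]
  refine intervalIntegral.integral_mono_on zero_le_one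
    (Continuous.intervalIntegrable (by fun_prop) _ _) (intervalIntegrable_radialMean n hgc σ)
    fun t ht => mul_le_mul_of_nonneg_left (hm _ ⟨by positivity, ?_⟩) (pow_nonneg ht.1 n)
  exact mul_le_of_le_one_right hσ (pow_le_one₀ ht.1 ht.2)

lemma not_linear_le_rpow {a c θ : ℝ} (ha : 0 < a) (hθ : θ < 1)
    (h : ∀ σ : ℝ, 1 ≤ σ → a * σ ≤ c * σ ^ θ) : False := by
  obtain ⟨σ, h1, h2⟩ := (((tendsto_rpow_atTop (sub_pos.2 hθ)).eventually_gt_atTop (c / a)).and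
    (eventually_ge_atTop 1)).exists
  have hσ : 0 < σ := by linarith
  have h3 := h σ h2
  rw [div_lt_iff₀ ha] at h1
  have h4 : σ = σ ^ (1 - θ) * σ ^ θ := by
    rw [← Real.rpow_add hσ]; simp
  have h5 := mul_lt_mul_of_pos_right h1 (Real.rpow_pos_of_pos hσ θ)
  rw [mul_right_comm, ← h4] at h5
  linarith

/-- In the subcritical range, radial solutions of `-Δ F = F ^ p` cannot stay positive. -/
lemma exists_nonpos_of_radial_ode {n : ℕ} {p : ℝ} (hp : 1 < p)
    (hθ : ((n + 1 : ℝ) / 2 - 1) * (p - 1) < 1) {F : ℝ → ℝ} (hF : ContDiff ℝ 2 F)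
    (hF0 : F 0 = 1)
    (hle : ∀ σ, 0 ≤ σ → 0 < F σ → deriv F σ ≤ -(F σ ^ p / (2 * (n + 1))))
    (hode : ∀ σ, 0 ≤ σ → 0 < F σ →
      4 * σ * deriv (deriv F) σ + 2 * (n + 1) * deriv F σ = -(F σ ^ p)) :
    ∃ σ, 0 ≤ σ ∧ F σ ≤ 0 := by
  by_contra! hpos
  have hd : ∀ σ, HasDerivAt F (deriv F σ) σ := hF.hasDerivAt_of_two
  have hd2 : ∀ σ, HasDerivAt (deriv F) (deriv (deriv F) σ) σ := hF.hasDerivAt_deriv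
  set ν : ℝ := (n + 1 : ℝ) / 2 with hν
  have hν0 : 0 < ν := by positivity
  set a : ℝ := (p - 1) / (4 * ν) with ha
  have ha0 : 0 < a := div_pos (sub_pos.2 hp) (by positivity)
  have hQ : ∀ σ, 0 ≤ σ → HasDerivAt (fun s => F s ^ (1 - p))
      (deriv F σ * (1 - p) * F σ ^ (1 - p - 1)) σ := fun σ hσ =>
    (hd σ).rpow_const (Or.inl (hpos σ hσ).ne')
  have hlow : ∀ σ, 0 ≤ σ → a * σ ≤ F σ ^ (1 - p) := by
    intro σ hσ
    have := Convex.mul_sub_le_image_sub_of_le_deriv (convex_Ici (0 : ℝ))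
      (f := fun s => F s ^ (1 - p)) (C := a)
      (fun x hx => (hQ x hx).continuousAt.continuousWithinAt)
      (fun x hx => (hQ x (interior_subset hx)).differentiableAt.differentiableWithinAt)
      (fun x hx => ?_) 0 self_mem_Ici σ hσ hσ
    · simp only [hF0, Real.one_rpow, sub_zero] at this
      linarith
    have hx0 : 0 ≤ x := interior_subset hx
    rw [(hQ x hx0).deriv, show 1 - p - 1 = -p by ring]
    have h1 := hle x hx0 (hpos x hx0)
    have h2 : F x ^ p * F x ^ (-p) = 1 := by
      rw [← Real.rpow_add (hpos x hx0)]; simp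
    have h3 := mul_le_mul_of_nonneg_right h1
      (mul_pos (sub_pos.2 hp) (Real.rpow_pos_of_pos (hpos x hx0) (-p))).le
    have h4 : -(F x ^ p / (2 * (n + 1 : ℝ))) * ((p - 1) * F x ^ (-p)) = -a := by
      rw [ha, hν]
      have : -(F x ^ p / (2 * (n + 1 : ℝ))) * ((p - 1) * F x ^ (-p)) =
        -((F x ^ p * F x ^ (-p)) * (p - 1) / (2 * (n + 1 : ℝ))) := by ring
      rw [this, h2]
      ring_nf
    rw [h4] at h3
    linarith
  set q : ℝ := -deriv F 1 with hq
  have hq0 : 0 < q := by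
    have h1 := hle 1 zero_le_one (hpos 1 zero_le_one)
    have h2 : 0 < F 1 ^ p / (2 * (n + 1)) :=
      div_pos (Real.rpow_pos_of_pos (hpos 1 zero_le_one) _) (by positivity)
    linarith
  have hS : ∀ σ : ℝ, 0 < σ → HasDerivAt (fun s => s ^ ν * -deriv F s)
      (ν * σ ^ (ν - 1) * -deriv F σ + σ ^ ν * -deriv (deriv F) σ) σ := fun σ hσ =>
    (Real.hasDerivAt_rpow_const (Or.inl hσ.ne')).mul (hd2 σ).neg
  have hSmono : ∀ σ : ℝ, 1 ≤ σ → q ≤ σ ^ ν * -deriv F σ := by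
    intro σ hσ
    have hmono : MonotoneOn (fun s => s ^ ν * -deriv F s) (Ici 1) := by
      refine monotoneOn_of_deriv_nonneg (convex_Ici 1)
        (fun x hx => (hS x (zero_lt_one.trans_le hx)).continuousAt.continuousWithinAt)
        (fun x hx => (hS x (zero_lt_one.trans_le
          (interior_subset hx))).differentiableAt.differentiableWithinAt) fun x hx => ?_
      have hx0 : 0 < x := zero_lt_one.trans_le (interior_subset hx)
      rw [(hS x hx0).deriv]
      have h1 := hode x hx0.le (hpos x hx0.le)
      have h2 : x ^ ν = x ^ (ν - 1) * x := by
        rw [← Real.rpow_add_one hx0.ne']; simp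
      have h3 : ν * x ^ (ν - 1) * -deriv F x + x ^ ν * -deriv (deriv F) x =
          x ^ (ν - 1) * (-(4 * x * deriv (deriv F) x + 2 * (n + 1) * deriv F x) / 4) := by
        rw [h2, hν]; ring
      rw [h3, h1, neg_neg]
      have := Real.rpow_pos_of_pos (hpos x hx0.le) p
      have := Real.rpow_pos_of_pos hx0 (ν - 1)
      positivity
    have := hmono (self_mem_Ici (a := (1 : ℝ))) hσ hσ
    simpa only [Real.one_rpow, one_mul] using this
  have hlow2 : ∀ σ : ℝ, 1 ≤ σ → q * 2 ^ (-ν) * σ ^ (1 - ν) ≤ F σ := by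
    intro σ hσ
    have hσ0 : 0 < σ := by linarith
    have := Convex.image_sub_le_mul_sub_of_deriv_le (convex_Icc σ (2 * σ)) (f := F)
      (C := -(q * (2 * σ) ^ (-ν)))
      (fun x _ => (hd x).continuousAt.continuousWithinAt)
      (fun x _ => (hd x).differentiableAt.differentiableWithinAt)
      (fun x hx => ?_) σ (left_mem_Icc.2 (by linarith)) (2 * σ) (right_mem_Icc.2 (by linarith))
      (by linarith)
    · have h1 := hpos (2 * σ) (by linarith)
      have h2 : q * 2 ^ (-ν) * σ ^ (1 - ν) = q * (2 * σ) ^ (-ν) * σ := by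
        rw [Real.mul_rpow zero_le_two hσ0.le, sub_eq_neg_add, Real.rpow_add_one hσ0.ne']
        ring
      rw [h2]
      have h3 : -(q * (2 * σ) ^ (-ν)) * (2 * σ - σ) = -(q * (2 * σ) ^ (-ν) * σ) := by ring
      rw [h3] at this
      linarith
    · have hx' := interior_subset hx
      have hx0 : 0 < x := hσ0.trans_le hx'.1
      have h1 := hSmono x (hσ.trans hx'.1)
      have h2 : x ^ (-ν) * x ^ ν = 1 := by rw [← Real.rpow_add hx0]; simp
      have h3 := mul_le_mul_of_nonneg_left h1 (Real.rpow_pos_of_pos hx0 (-ν)).le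
      rw [← mul_assoc, h2, one_mul] at h3
      have h4 : (2 * σ) ^ (-ν) ≤ x ^ (-ν) :=
        Real.rpow_le_rpow_of_nonpos hx0 hx'.2 (by linarith)
      have h5 := mul_le_mul_of_nonneg_right h4 hq0.le
      linarith
  refine not_linear_le_rpow (c := (q * 2 ^ (-ν)) ^ (1 - p)) (θ := (ν - 1) * (p - 1)) ha0 hθ
    fun σ hσ => ?_
  have hσ0 : 0 < σ := by linarith
  have hc : 0 < q * 2 ^ (-ν) := by positivity
  refine (hlow σ hσ0.le).trans ?_
  have h1 := Real.rpow_le_rpow_of_nonpos (z := 1 - p) (by positivity) (hlow2 σ hσ) (by linarith)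
  rw [Real.mul_rpow hc.le (by positivity), ← Real.rpow_mul hσ0.le] at h1
  refine h1.trans_eq ?_
  congr 2
  ring

/-- A radial profile, in the variable `σ = r ^ 2`, which is positive on `[0, ρ)` and vanishes at
`ρ`. -/
lemma exists_radial_profile {n : ℕ} {p : ℝ} (hp : 1 < p)
    (hθ : ((n + 1 : ℝ) / 2 - 1) * (p - 1) < 1) :
    ∃ (F : ℝ → ℝ) (ρ : ℝ), ContDiff ℝ 2 F ∧ 0 < ρ ∧ F ρ = 0 ∧
      (∀ σ, 0 ≤ σ → σ < ρ → 0 < F σ) ∧ ∀ σ, 0 ≤ σ → σ < ρ →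
        4 * σ * deriv (deriv F) σ + 2 * (n + 1) * deriv F σ = -(F σ ^ p) := by
  obtain ⟨f, k, hf, hk, hkp, hf0, hfm, hfnn, hfp⟩ := exists_truncated_rpow hp
  obtain ⟨F, hF, hF0, hF', hode⟩ := exists_radial_solution n (zero_lt_one.trans hp) hf hk hkp hf0
  have hfc : Continuous f := continuous_iff_continuousAt.2 fun x => (hf x).continuousAt
  have hanti : Antitone F := antitone_of_deriv_nonpos (hF.differentiable (by norm_num))
    fun σ => by
      rw [hF']
      have := radialMean_nonneg n (fun s => hfnn (F s)) σ
      linarith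
  have hpow : ∀ σ, 0 ≤ σ → 0 < F σ → f (F σ) = F σ ^ p := fun σ hσ h =>
    hfp _ ⟨h.le, hF0 ▸ hanti hσ⟩
  obtain ⟨b, hb, hFb⟩ := exists_nonpos_of_radial_ode hp hθ hF hF0 (fun σ hσ h => by
    have h1 := le_radialMean n (hfc.comp hF.continuous) (m := f (F σ)) hσ
      fun s hs => hfm (hanti hs.2)
    rw [hF', ← hpow σ hσ h]
    have h2 : f (F σ) / (2 * (n + 1)) = 1 / 2 * (f (F σ) / (n + 1)) := by
      field_simp
    rw [h2]
    have h3 : radialMean n (f ∘ F) σ = radialMean n (fun s => f (F s)) σ := rfl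
    rw [h3] at h1
    linarith) (fun σ hσ h => by rw [hode, hpow σ hσ h])
  obtain ⟨c, hc, hFc⟩ : ∃ c ∈ Icc 0 b, F c = 0 :=
    intermediate_value_Icc' hb hF.continuous.continuousOn ⟨hFb, hF0 ▸ zero_le_one⟩
  have hcl : IsClosed (Ici (0 : ℝ) ∩ F ⁻¹' {0}) :=
    isClosed_Ici.inter (isClosed_singleton.preimage hF.continuous)
  have hbdd : BddBelow (Ici (0 : ℝ) ∩ F ⁻¹' {0}) := ⟨0, fun x hx => hx.1⟩
  obtain ⟨h0, hz⟩ := hcl.csInf_mem ⟨c, hc.1, hFc⟩ hbdd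
  set ρ := sInf (Ici (0 : ℝ) ∩ F ⁻¹' {0})
  have hz : F ρ = 0 := hz
  have hpos : ∀ σ, 0 ≤ σ → σ < ρ → 0 < F σ := fun σ hσ h =>
    lt_of_le_of_ne (hz ▸ hanti h.le) fun he => notMem_of_lt_csInf h hbdd ⟨hσ, he.symm⟩
  refine ⟨F, ρ, hF, lt_of_le_of_ne h0 fun he => ?_, hz, hpos, fun σ hσ h => ?_⟩
  · rw [← he, hF0] at hz
    exact one_ne_zero hz
  · rw [hode, hpow σ hσ (hpos σ hσ h)]

variable {E : Type*} [NormedAddCommGroup E] [InnerProductSpace ℝ E] [FiniteDimensional ℝ E]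

/-- Existence of a positive radial solution of the Emden problem in the unit ball. -/
theorem exists_isBallSolution_rpow {n : ℕ} (hE : Module.finrank ℝ E = n + 1) {p : ℝ} (hp : 1 < p)
    (hθ : ((n + 1 : ℝ) / 2 - 1) * (p - 1) < 1) :
    ∃ u : E → ℝ, IsBallSolution (fun x => x ^ p) u := by
  obtain ⟨F, ρ, hF, hρ, hFρ, hpos, hode⟩ := exists_radial_profile (n := n) hp hθ
  set A : ℝ := ρ ^ (1 / (p - 1)) with hA
  have hA0 : 0 < A := Real.rpow_pos_of_pos hρ _
  have hAp : A ^ p = A * ρ := by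
    have h1 : A ^ (p - 1) = ρ := by
      rw [hA, ← Real.rpow_mul hρ.le, one_div_mul_cancel (sub_pos.2 hp).ne', Real.rpow_one]
    rw [show p = (p - 1) + 1 by ring, Real.rpow_add_one hA0.ne', h1, mul_comm]
  let G : ℝ → ℝ := fun s => A * F (ρ * s)
  have hG : ContDiff ℝ 2 G := contDiff_const.mul (hF.comp (contDiff_const.mul contDiff_id))
  have hm : ∀ s : ℝ, HasDerivAt (fun s => ρ * s) ρ s := fun s => by
    simpa using (hasDerivAt_id s).const_mul ρ
  have hG1 : deriv G = fun s => A * (deriv F (ρ * s) * ρ) := funext fun s =>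
    ((HasDerivAt.comp (h := fun s => ρ * s) s (hF.hasDerivAt_of_two (ρ * s)) (hm s)).const_mul
      A).deriv
  have hG2 : deriv (deriv G) = fun s => A * (deriv (deriv F) (ρ * s) * ρ * ρ) := by
    rw [hG1]
    exact funext fun s => (((HasDerivAt.comp (h := fun s => ρ * s) s
      (hF.hasDerivAt_deriv (ρ * s)) (hm s)).mul_const ρ).const_mul A).deriv
  refine ⟨fun x => G (‖x - 0‖ ^ 2), ?_, fun x hx => ?_, fun x hx => ?_, fun x hx => ?_⟩
  · exact hG.comp ((contDiff_id.sub contDiff_const).norm_sq ℝ)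
  · rw [laplacian_comp_norm_sq (0 : E) x hG.contDiffAt, hG2, hG1, hE, sub_zero]
    have hx2 : ‖x‖ ^ 2 < 1 := pow_lt_one₀ (norm_nonneg x) hx two_ne_zero
    have h0 : 0 ≤ ρ * ‖x‖ ^ 2 := by positivity
    have h1 : ρ * ‖x‖ ^ 2 < ρ := mul_lt_of_lt_one_right hρ hx2
    have h2 := hode _ h0 h1
    simp only [G]
    rw [Real.mul_rpow hA0.le (hpos _ h0 h1).le, hAp]
    have h3 : -(A * ρ * F (ρ * ‖x‖ ^ 2) ^ p) = A * ρ * -(F (ρ * ‖x‖ ^ 2) ^ p) := by ring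
    rw [h3, ← h2]
    push_cast
    ring
  · have hx2 : ‖x‖ ^ 2 < 1 := pow_lt_one₀ (norm_nonneg x) hx two_ne_zero
    simp only [G, sub_zero]
    exact mul_pos hA0 (hpos _ (by positivity) (mul_lt_of_lt_one_right hρ hx2))
  · simp [G, hx, hFρ]

end

lemma lapl_eq_laplacian {N : ℕ} {f : EuclideanSpace ℝ (Fin N) → ℝ} (hf : ContDiff ℝ 2 f)
    (x : EuclideanSpace ℝ (Fin N)) : lapl f x = (Δ f) x := by
  rw [laplacian_eq_sum_fderiv_fderiv (EuclideanSpace.basisFun (Fin N) ℝ) f x]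
  have hd : DifferentiableAt ℝ (fderiv ℝ f) x :=
    ((hf.fderiv_right (m := 1) (by norm_num)).differentiable (by norm_num)).differentiableAt
  refine Finset.sum_congr rfl fun i _ => ?_
  rw [EuclideanSpace.basisFun_apply, fderiv_clm_apply hd (differentiableAt_const _)]
  simp

lemma isEmden_ball_iff {N : ℕ} (hN : 0 < N) {p : ℝ} {u : EuclideanSpace ℝ (Fin N) → ℝ} :
    IsEmden (ball (0 : EuclideanSpace ℝ (Fin N)) 1) p u ↔ IsBallSolution (fun x => x ^ p) u := by
  have : Nonempty (Fin N) := ⟨⟨0, hN⟩⟩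
  constructor
  · rintro ⟨h1, h2, h3, h4⟩
    refine ⟨h1, fun x hx => ?_, fun x hx => h3 x (by simpa using hx), fun x hx => h4 x ?_⟩
    · rw [← lapl_eq_laplacian h1, ← h2 x (by simpa using hx), neg_neg]
    · rw [frontier_ball _ one_ne_zero]
      simpa using hx
  · rintro ⟨h1, h2, h3, h4⟩
    refine ⟨h1, fun x hx => ?_, fun x hx => h3 x (by simpa using hx), fun x hx => h4 x ?_⟩
    · rw [lapl_eq_laplacian h1, h2 x (by simpa using hx), neg_neg]
    · rw [frontier_ball _ one_ne_zero] at hx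
      simpa using hx

end

theorem stmt18 (N : ℕ) (hN : 2 ≤ N) (p : ℝ) (hp1 : 1 < p)
    (hpN : N = 2 ∨ p < (N : ℝ) / ((N : ℝ) - 2)) :
    (∃ u : EuclideanSpace ℝ (Fin N) → ℝ,
      IsEmden (ball (0 : EuclideanSpace ℝ (Fin N)) 1) p u) ∧
    ∀ u v : EuclideanSpace ℝ (Fin N) → ℝ,
      IsEmden (ball (0 : EuclideanSpace ℝ (Fin N)) 1) p u →
      IsEmden (ball (0 : EuclideanSpace ℝ (Fin N)) 1) p v →
      ∀ x ∈ closure (ball (0 : EuclideanSpace ℝ (Fin N)) 1), u x = v x := by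
  have hN0 : 0 < N := by lia
  constructor
  · obtain ⟨n, rfl⟩ : ∃ n, N = n + 1 := ⟨N - 1, by lia⟩
    have hθ : ((n + 1 : ℝ) / 2 - 1) * (p - 1) < 1 := by
      rcases hN.eq_or_lt with h | h
      · have hn : (n : ℝ) = 1 := by
          have : n = 1 := by lia
          exact_mod_cast this
        rw [hn]
        norm_num
      · have hn : (0 : ℝ) < (n : ℝ) + 1 - 2 := by
          have : (2 : ℝ) < ((n + 1 : ℕ) : ℝ) := by exact_mod_cast h
          push_cast at this
          linarith
        have hp := hpN.resolve_left h.ne'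
        push_cast at hp
        rw [lt_div_iff₀ hn] at hp
        linarith
    obtain ⟨u, hu⟩ := exists_isBallSolution_rpow
      (E := EuclideanSpace ℝ (Fin (n + 1))) finrank_euclideanSpace_fin hp1 hθ
    exact ⟨u, (isEmden_ball_iff hN0).2 hu⟩
  · intro u v hu hv x hx
    rw [closure_ball _ one_ne_zero, mem_closedBall_zero_iff] at hx
    exact ((isEmden_ball_iff hN0).1 hu).eq_of_rpow hp1 ((isEmden_ball_iff hN0).1 hv) hx
      (by rwa [finrank_euclideanSpace_fin])

end
end
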